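/- Let λ > 0 and Q > 0. For n ∈ ℤ₊ set Λ_n = r_n = 2^n, and suppose (V_n) is a sequence of continuous periodic potentials with periods T_n satisfying T_1 > 1, T_{n} ≥ 2 T_{n-1}, ‖V_n‖_∞ ≤ Q for all n, and suppose V_∞ is a bounded continuous function such that, for all n with λ ∈ [Λ_n^{-1}, Λ_n], one has ‖λ V_n - λ V_∞‖_∞ ≤ δ_n/2 where δ_n := Leb(σ(H_{λ V_n}) ∩ [-r_n, r_n]) satisfies δ_n < e^{-T_n^{1/2}}. Then the spectrum σ(H_{λ V_∞}) has Hausdorff dimension zero; moreover h^α(σ(H_{λ V_∞})) = 0 for every α > 0. -/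

import Mathlib

open MeasureTheory Filter Set BoundedContinuousFunction
open scoped ENNReal

noncomputable section
/-- The spectrum of the Schrödinger operator `H_V φ = -φ'' + Vφ` on `L²(ℝ)`, characterized
via Weyl sequences drawn from the core `C_c²(ℝ)` of the (essentially self-adjoint) operator:
`E ∈ σ(H_V)` iff there are compactly supported `C²` functions `u` of unit `L²` norm with
`‖(H_V - E)u‖_{L²}` arbitrarily small. -/
def schrodingerSpectrum (V : ℝ → ℝ) : Set ℝ :=
  {E : ℝ | ∀ ε : ℝ, 0 < ε → ∃ u : ℝ → ℂ,
    ContDiff ℝ 2 u ∧ HasCompactSupport u ∧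
    (∫ x : ℝ, ‖u x‖ ^ 2) = 1 ∧
    (∫ x : ℝ, ‖-deriv (deriv u) x + (V x : ℂ) * u x - (E : ℂ) * u x‖ ^ 2) < ε}

theorem norm_int_le (f : ℝ → ℂ) (G : ℝ → ℝ) (hG : Continuous G)
    (h : ∀ t, ‖f t‖ ≤ G |t|) (x : ℝ) :
    ‖∫ t in (0:ℝ)..x, f t‖ ≤ ∫ t in (0:ℝ)..|x|, G t := by
  rcases le_total 0 x with hx | hx
  · rw [abs_of_nonneg hx]
    refine intervalIntegral.norm_integral_le_of_norm_le hx ?_ (hG.intervalIntegrable _ _)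
    refine Eventually.of_forall fun t ht => ?_
    have := h t
    rwa [abs_of_pos ht.1] at this
  · rw [abs_of_nonpos hx]
    have : ∫ t in (0:ℝ)..x, f t = - ∫ t in (0:ℝ)..(-x), f (-t) := by
      rw [intervalIntegral.integral_comp_neg, intervalIntegral.integral_symm]; simp
    rw [this, norm_neg]
    refine intervalIntegral.norm_integral_le_of_norm_le (by linarith) ?_
      (hG.intervalIntegrable _ _)
    refine Eventually.of_forall fun t ht => ?_
    have := h (-t)
    rwa [abs_neg, abs_of_pos ht.1] at this

def pic (q : ℝ → ℂ) (a b : ℂ) : ℕ → ℝ → ℂ × ℂ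
  | 0 => fun _ => (a, b)
  | k + 1 => fun x => (∫ t in (0:ℝ)..x, (pic q a b k t).2,
      ∫ t in (0:ℝ)..x, q t * (pic q a b k t).1)

theorem pic_cont {q : ℝ → ℂ} (hq : Continuous q) (a b : ℂ) (k : ℕ) :
    Continuous (pic q a b k) := by
  induction k with
  | zero => exact continuous_const
  | succ k ih =>
    refine Continuous.prodMk ?_ ?_
    · exact intervalIntegral.continuous_primitive
        (fun a b => (continuous_snd.comp ih).intervalIntegrable _ _) _
    · exact intervalIntegral.continuous_primitive
        (fun a b => (hq.mul (continuous_fst.comp ih)).intervalIntegrable _ _) _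

theorem int_exp_bound (A K x : ℝ) (hA : 0 ≤ A) :
    ∫ t in (0:ℝ)..x, K * (A * Real.exp (2 * K * t)) ≤ A / 2 * Real.exp (2 * K * x) := by
  have : ∫ t in (0:ℝ)..x, K * (A * Real.exp (2 * K * t)) =
      A / 2 * Real.exp (2 * K * x) - A / 2 * Real.exp (2 * K * 0) := by
    apply intervalIntegral.integral_eq_sub_of_hasDerivAt
    · intro t _
      have h := ((Real.hasDerivAt_exp (2 * K * t)).comp t
        ((hasDerivAt_id t).const_mul (2 * K))).const_mul (A / 2)
      convert! h using 1
      simp; ring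
    · exact Continuous.intervalIntegrable (by fun_prop) _ _
  rw [this]; simp; linarith

theorem pic_bound {q : ℝ → ℂ} {K : ℝ} (hK : 1 ≤ K) (hqK : ∀ t, ‖q t‖ ≤ K)
    (a b : ℂ) (ha : ‖a‖ ≤ 1) (hb : ‖b‖ ≤ 1) (k : ℕ) (x : ℝ) :
    ‖(pic q a b k x).1‖ ≤ (1/2)^k * Real.exp (2 * K * |x|) ∧
    ‖(pic q a b k x).2‖ ≤ (1/2)^k * Real.exp (2 * K * |x|) := by
  induction k generalizing x with
  | zero =>
    have : 1 ≤ Real.exp (2 * K * |x|) := Real.one_le_exp (by positivity)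
    simp only [pic]; constructor <;> simp <;> linarith
  | succ k ih =>
    have hK0 : 0 < K := by linarith
    have hb := int_exp_bound ((1/2)^k) K |x| (by positivity)
    have he : (1/2:ℝ)^k / 2 = (1/2)^(k+1) := by ring
    rw [he] at hb
    constructor
    · refine le_trans (norm_int_le _ (fun t => K * ((1/2)^k * Real.exp (2 * K * t)))
        (by fun_prop) ?_ x) hb
      intro t
      refine (ih t).2.trans ?_
      exact le_mul_of_one_le_left (by positivity) hK
    · refine le_trans (norm_int_le _ (fun t => K * ((1/2)^k * Real.exp (2 * K * t)))
        (by fun_prop) ?_ x) hb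
      intro t
      rw [norm_mul]
      exact mul_le_mul (hqK t) (ih t).1 (norm_nonneg _) hK0.le

def sol1 (q : ℝ → ℂ) (a b : ℂ) (x : ℝ) : ℂ := ∑' k, (pic q a b k x).1
def sol2 (q : ℝ → ℂ) (a b : ℂ) (x : ℝ) : ℂ := ∑' k, (pic q a b k x).2

theorem sum_bd (M : ℝ) : Summable (fun k : ℕ => (1/2:ℝ)^k * M) :=
  (summable_geometric_of_lt_one (by norm_num) (by norm_num)).mul_right M

section
variable {q : ℝ → ℂ} {K : ℝ} (hK : 1 ≤ K) (hqK : ∀ t, ‖q t‖ ≤ K) (a b : ℂ)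
    (ha : ‖a‖ ≤ 1) (hb : ‖b‖ ≤ 1)
include hK hqK ha hb

theorem pic_summable1 (x : ℝ) : Summable (fun k => (pic q a b k x).1) :=
  Summable.of_norm_bounded (sum_bd _) fun k => (pic_bound hK hqK a b ha hb k x).1

theorem pic_summable2 (x : ℝ) : Summable (fun k => (pic q a b k x).2) :=
  Summable.of_norm_bounded (sum_bd _) fun k => (pic_bound hK hqK a b ha hb k x).2

theorem sol1_bound (x : ℝ) : ‖sol1 q a b x‖ ≤ 2 * Real.exp (2 * K * |x|) := by
  have h := tsum_of_norm_bounded (hasSum_geometric_two.mul_right (Real.exp (2 * K * |x|)))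
    fun k => (pic_bound hK hqK a b ha hb k x).1
  exact h

theorem sol2_bound (x : ℝ) : ‖sol2 q a b x‖ ≤ 2 * Real.exp (2 * K * |x|) := by
  have h := tsum_of_norm_bounded (hasSum_geometric_two.mul_right (Real.exp (2 * K * |x|)))
    fun k => (pic_bound hK hqK a b ha hb k x).2
  exact h

theorem sol1_deriv (hq : Continuous q) (x : ℝ) :
    HasDerivAt (sol1 q a b) (sol2 q a b x) x := by
  have h := hasDerivAt_tsum_of_isPreconnected
    (g := fun k y => (pic q a b k y).1)
    (g' := fun k y => match k with | 0 => 0 | k+1 => (pic q a b k y).2)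
    (u := fun k => (1/2:ℝ)^k * (2 * Real.exp (2 * K * (|x|+1))))
    (t := Metric.ball x 1) (y₀ := x) (y := x) (sum_bd _) Metric.isOpen_ball
    (convex_ball x 1).isPreconnected ?_ ?_ (by simp) (pic_summable1 hK hqK a b ha hb x) (by simp)
  · convert! h using 1
    rw [Summable.tsum_eq_zero_add]
    · simp [sol2]
    · rw [← summable_nat_add_iff 1]
      exact pic_summable2 hK hqK a b ha hb x
  · intro k y _
    cases k with
    | zero => exact hasDerivAt_const _ _
    | succ k =>
      have hc := continuous_snd.comp (pic_cont hq a b k)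
      exact intervalIntegral.integral_hasDerivAt_right (hc.intervalIntegrable _ _)
        (hc.stronglyMeasurableAtFilter _ _) hc.continuousAt
  · intro k y hy
    cases k with
    | zero => simp; positivity
    | succ k =>
      refine (pic_bound hK hqK a b ha hb k y).2.trans ?_
      have h1 : |y| ≤ |x| + 1 := by
        have := abs_sub_abs_le_abs_sub y x
        rw [Metric.mem_ball, Real.dist_eq] at hy; linarith
      have h2 : Real.exp (2 * K * |y|) ≤ Real.exp (2 * K * (|x|+1)) := by
        apply Real.exp_le_exp.2; gcongr
      calc _ ≤ (1/2:ℝ)^k * Real.exp (2 * K * (|x|+1)) := by gcongr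
        _ = _ := by ring

theorem sol2_deriv (hq : Continuous q) (x : ℝ) :
    HasDerivAt (sol2 q a b) (q x * sol1 q a b x) x := by
  have h := hasDerivAt_tsum_of_isPreconnected
    (g := fun k y => (pic q a b k y).2)
    (g' := fun k y => match k with | 0 => 0 | k+1 => q y * (pic q a b k y).1)
    (u := fun k => (1/2:ℝ)^k * (2 * (K * Real.exp (2 * K * (|x|+1)))))
    (t := Metric.ball x 1) (y₀ := x) (y := x) (sum_bd _) Metric.isOpen_ball
    (convex_ball x 1).isPreconnected ?_ ?_ (by simp) (pic_summable2 hK hqK a b ha hb x) (by simp)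
  · convert! h using 1
    rw [Summable.tsum_eq_zero_add]
    · simp [sol1, tsum_mul_left]
    · rw [← summable_nat_add_iff 1]
      exact (pic_summable1 hK hqK a b ha hb x).mul_left _
  · intro k y _
    cases k with
    | zero => exact hasDerivAt_const _ _
    | succ k =>
      have hc := hq.mul (continuous_fst.comp (pic_cont hq a b k))
      exact intervalIntegral.integral_hasDerivAt_right (hc.intervalIntegrable _ _)
        (hc.stronglyMeasurableAtFilter _ _) hc.continuousAt
  · intro k y hy
    cases k with
    | zero => simp; positivity
    | succ k =>
      have h1 : |y| ≤ |x| + 1 := by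
        have := abs_sub_abs_le_abs_sub y x
        rw [Metric.mem_ball, Real.dist_eq] at hy; linarith
      have h2 : Real.exp (2 * K * |y|) ≤ Real.exp (2 * K * (|x|+1)) := by
        apply Real.exp_le_exp.2; gcongr
      calc _ ≤ K * ((1/2:ℝ)^k * Real.exp (2 * K * |y|)) := by
            simp only [norm_mul]
            exact mul_le_mul (hqK y) (pic_bound hK hqK a b ha hb k y).1 (norm_nonneg _)
              (by linarith)
        _ ≤ K * ((1/2:ℝ)^k * Real.exp (2 * K * (|x|+1))) := by gcongr
        _ = _ := by ring
end

theorem pic_zero (q : ℝ → ℂ) (a b : ℂ) (k : ℕ) : pic q a b (k+1) 0 = 0 := by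
  simp [pic]

theorem sol1_zero (q : ℝ → ℂ) (a b : ℂ) : sol1 q a b 0 = a := by
  unfold sol1
  rw [tsum_eq_single 0]
  · rfl
  · intro k hk
    obtain ⟨j, rfl⟩ := Nat.exists_eq_succ_of_ne_zero hk
    simp [pic_zero]

theorem sol2_zero (q : ℝ → ℂ) (a b : ℂ) : sol2 q a b 0 = b := by
  unfold sol2
  rw [tsum_eq_single 0]
  · rfl
  · intro k hk
    obtain ⟨j, rfl⟩ := Nat.exists_eq_succ_of_ne_zero hk
    simp [pic_zero]

/-- functions polynomial in the spectral parameter -/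
inductive PolyF : (ℂ → ℝ → ℂ) → Prop
  | base (a : ℝ → ℂ) (h : Continuous a) : PolyF (fun _ x => a x)
  | add (f g : ℂ → ℝ → ℂ) : PolyF f → PolyF g → PolyF (fun z x => f z x + g z x)
  | mulz (f : ℂ → ℝ → ℂ) : PolyF f → PolyF (fun z x => z * f z x)

theorem PolyF.cont {f : ℂ → ℝ → ℂ} (h : PolyF f) (z : ℂ) : Continuous (f z) := by
  induction h with
  | base a h => exact h
  | add f g _ _ hf hg => exact hf.add hg
  | mulz f _ hf => exact continuous_const.mul hf

theorem PolyF.diff {f : ℂ → ℝ → ℂ} (h : PolyF f) (x : ℝ) :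
    Differentiable ℂ (fun z => f z x) := by
  induction h with
  | base a h => exact differentiable_const _
  | add f g _ _ hf hg => exact hf.add hg
  | mulz f _ hf => exact differentiable_id.mul hf

theorem PolyF.mulW {f : ℂ → ℝ → ℂ} (h : PolyF f) {W : ℝ → ℂ} (hW : Continuous W) :
    PolyF (fun z x => W x * f z x) := by
  induction h with
  | base a h => exact PolyF.base (fun x => W x * a x) (hW.mul h)
  | add f g _ _ hf hg =>
    have := PolyF.add _ _ hf hg
    simpa only [mul_add] using this
  | mulz f _ hf =>
    have := PolyF.mulz _ hf
    simpa only [mul_left_comm] using this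

theorem PolyF.prim {f : ℂ → ℝ → ℂ} (h : PolyF f) :
    PolyF (fun z x => ∫ t in (0:ℝ)..x, f z t) := by
  induction h with
  | base a h =>
    exact PolyF.base _ (intervalIntegral.continuous_primitive
        (fun _ _ => h.intervalIntegrable _ _) _)
  | add f g hf' hg' hf hg =>
    have := PolyF.add _ _ hf hg
    convert! this using 3 with z x
    exact intervalIntegral.integral_add ((hf'.cont z).intervalIntegrable _ _)
      ((hg'.cont z).intervalIntegrable _ _)
  | mulz f _ hf =>
    have := PolyF.mulz _ hf
    convert! this using 3 with z x
    exact intervalIntegral.integral_const_mul _ _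

theorem pic_poly {W : ℝ → ℂ} (hW : Continuous W) (a b : ℂ) (k : ℕ) :
    PolyF (fun z x => (pic (fun t => W t - z) a b k x).1) ∧
    PolyF (fun z x => (pic (fun t => W t - z) a b k x).2) := by
  induction k with
  | zero => exact ⟨PolyF.base _ continuous_const, PolyF.base _ continuous_const⟩
  | succ k ih =>
    refine ⟨ih.2.prim, ?_⟩
    have h1 := PolyF.mulz _ ih.1
    have h3 := h1.mulW (W := fun _ => (-1:ℂ)) continuous_const
    have h4 := (PolyF.add _ _ (ih.1.mulW hW) h3).prim
    convert! h4 using 3 with z x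
    simp only [pic]
    congr 1
    funext t
    ring

theorem sol_analytic {W : ℝ → ℂ} (hW : Continuous W) {K : ℝ}
    (hWK : ∀ t, ‖W t‖ ≤ K) (a b : ℂ) (ha : ‖a‖ ≤ 1) (hb : ‖b‖ ≤ 1) (x : ℝ) :
    Differentiable ℂ (fun z => sol1 (fun t => W t - z) a b x) ∧
    Differentiable ℂ (fun z => sol2 (fun t => W t - z) a b x) := by
  have hK0 : 0 ≤ K := (norm_nonneg _).trans (hWK 0)
  have key : ∀ z0 z : ℂ, z ∈ Metric.ball z0 1 → ∀ t, ‖W t - z‖ ≤ K + ‖z0‖ + 1 := by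
    intro z0 z hz t
    have h1 := norm_sub_le (W t) z
    have h2 := hWK t
    have h3 : ‖z‖ ≤ ‖z0‖ + 1 := by
      have := norm_sub_norm_le z z0
      rw [Metric.mem_ball, dist_eq_norm] at hz; linarith
    linarith
  constructor
  · intro z0
    refine (Complex.differentiableOn_tsum_of_summable_norm (u := fun k => _)
      (sum_bd (Real.exp (2 * (K + ‖z0‖ + 1) * |x|)))
      (fun k => ((pic_poly hW a b k).1.diff x).differentiableOn) Metric.isOpen_ball
      (fun k z hz => (pic_bound ?_ (key z0 z hz) a b ha hb k x).1)).differentiableAt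
      (Metric.ball_mem_nhds z0 one_pos)
    linarith [norm_nonneg z0]
  · intro z0
    refine (Complex.differentiableOn_tsum_of_summable_norm (u := fun k => _)
      (sum_bd (Real.exp (2 * (K + ‖z0‖ + 1) * |x|)))
      (fun k => ((pic_poly hW a b k).2.diff x).differentiableOn) Metric.isOpen_ball
      (fun k z hz => (pic_bound ?_ (key z0 z hz) a b ha hb k x).2)).differentiableAt
      (Metric.ball_mem_nhds z0 one_pos)
    linarith [norm_nonneg z0]

theorem zero_count (c : ℂ) (r : ℝ) (hr : 0 < r) (s : Finset ℂ) :
    ∀ (F : ℂ → ℂ) (M : ℝ), Differentiable ℂ F → (∀ z, ‖z - c‖ ≤ 3 * r → ‖F z‖ ≤ M) →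
    (∀ z ∈ s, ‖z - c‖ ≤ r ∧ F z = 0) → ‖F c‖ * 2 ^ s.card ≤ M := by
  induction s using Finset.induction_on with
  | empty =>
    intro F M hF hM _
    simpa using hM c (by simp; positivity)
  | insert a s has ih =>
    intro F M hF hM hs
    have ha := hs a (by simp)
    have hFG : ∀ z, F z = (z - a) * dslope F a z := by
      intro z
      have := sub_smul_dslope F a z
      rw [ha.2, sub_zero, smul_eq_mul] at this
      exact this.symm
    have hG : Differentiable ℂ (dslope F a) := by
      rw [← differentiableOn_univ, Complex.differentiableOn_dslope univ_mem]
      exact hF.differentiableOn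
    have hbd : ∀ z, ‖z - c‖ ≤ 3 * r → ‖dslope F a z‖ ≤ M / (2 * r) := by
      intro z hz
      have hcl : closure (Metric.ball c (3 * r)) = Metric.closedBall c (3*r) :=
        closure_ball c (by positivity)
      refine Complex.norm_le_of_forall_mem_frontier_norm_le (U := Metric.ball c (3 * r))
        Metric.isBounded_ball hG.diffContOnCl ?_ ?_
      · intro w hw
        rw [frontier_ball c (by positivity)] at hw
        rw [mem_sphere_iff_norm] at hw
        have h1 := hM w hw.le
        rw [hFG w, norm_mul] at h1
        have h2 : 2 * r ≤ ‖w - a‖ := by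
          have := norm_sub_le_norm_sub_add_norm_sub w a c
          linarith [ha.1]
        rw [le_div_iff₀ (by positivity)]
        calc _ ≤ ‖dslope F a w‖ * ‖w - a‖ := by gcongr
          _ ≤ M := by linarith
      · rw [hcl, mem_closedBall_iff_norm]; exact hz
    have := ih (dslope F a) (M / (2*r)) hG hbd ?_
    · rw [Finset.card_insert_of_notMem has, hFG c, norm_mul, norm_sub_rev]
      rw [le_div_iff₀ (by positivity)] at this
      calc _ ≤ r * ‖dslope F a c‖ * 2 ^ (s.card + 1) := by gcongr; exact ha.1
        _ = ‖dslope F a c‖ * 2 ^ s.card * (2 * r) := by ring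
        _ ≤ M := this
    · intro z hz
      have h := hs z (Finset.mem_insert_of_mem hz)
      refine ⟨h.1, ?_⟩
      have hza : z - a ≠ 0 := by
        intro h0; rw [sub_eq_zero] at h0; exact has (h0 ▸ hz)
      have h3 := hFG z
      rw [h.2] at h3
      exact (mul_eq_zero.1 h3.symm).resolve_left hza

def disc (W : ℝ → ℝ) (T : ℝ) (z : ℂ) : ℂ :=
  sol1 (fun t => (W t : ℂ) - z) 1 0 T + sol2 (fun t => (W t : ℂ) - z) 0 1 T

theorem disc_diff {W : ℝ → ℝ} (hW : Continuous W) {K : ℝ} (hWK : ∀ t, |W t| ≤ K) (T : ℝ) :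
    Differentiable ℂ (disc W T) := by
  have hWc : Continuous (fun t => (W t : ℂ)) := by fun_prop
  have hb : ∀ t, ‖(W t : ℂ)‖ ≤ K := fun t => by simpa using hWK t
  exact (sol_analytic hWc hb 1 0 (by simp) (by simp) T).1.add
    (sol_analytic hWc hb 0 1 (by simp) (by simp) T).2

theorem disc_upper {W : ℝ → ℝ} {K : ℝ} (hWK : ∀ t, |W t| ≤ K) {T : ℝ} (hT : 0 ≤ T)
    (K' : ℝ) (hK' : 1 ≤ K') (z : ℂ) (hz : K + ‖z‖ ≤ K') :
    ‖disc W T z‖ ≤ 4 * Real.exp (2 * K' * T) := by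
  have hb : ∀ t, ‖(W t : ℂ) - z‖ ≤ K' := fun t => by
    have h1 := norm_sub_le (W t : ℂ) z
    have h2 : ‖(W t : ℂ)‖ ≤ K := by simpa using hWK t
    linarith
  have h1 := sol1_bound hK' hb 1 0 (by simp) (by simp) T
  have h2 := sol2_bound hK' hb 0 1 (by simp) (by simp) T
  rw [abs_of_nonneg hT] at h1 h2
  refine (norm_add_le _ _).trans ?_
  linarith

theorem pic_real {q : ℝ → ℝ} (hq : Continuous q) (hq0 : ∀ t, 0 ≤ q t) {a b : ℝ} (ha : 0 ≤ a)
    (hb : 0 ≤ b) (k : ℕ) : ∃ u v : ℝ → ℝ, Continuous u ∧ Continuous v ∧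
      (∀ x, pic (fun t => (q t : ℂ)) a b k x = ((u x : ℂ), (v x : ℂ))) ∧
      ∀ x, 0 ≤ x → 0 ≤ u x ∧ 0 ≤ v x := by
  induction k with
  | zero => exact ⟨fun _ => a, fun _ => b, continuous_const, continuous_const,
      fun x => rfl, fun x _ => ⟨ha, hb⟩⟩
  | succ k ih =>
    obtain ⟨u, v, hu, hv, he, hp⟩ := ih
    refine ⟨fun x => ∫ t in (0:ℝ)..x, v t, fun x => ∫ t in (0:ℝ)..x, q t * u t, ?_, ?_, ?_, ?_⟩
    · exact intervalIntegral.continuous_primitive (fun _ _ => hv.intervalIntegrable _ _) _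
    · exact intervalIntegral.continuous_primitive
        (fun _ _ => (hq.mul hu).intervalIntegrable _ _) _
    · intro x
      simp only [pic, he]
      rw [← intervalIntegral.integral_ofReal, ← intervalIntegral.integral_ofReal]
      simp
    · intro x hx
      exact ⟨intervalIntegral.integral_nonneg hx fun t ht => (hp t ht.1).2,
        intervalIntegral.integral_nonneg hx fun t ht =>
          mul_nonneg (hq0 t) (hp t ht.1).1⟩

theorem disc_lower {W : ℝ → ℝ} (hW : Continuous W) {K : ℝ} (hWK : ∀ t, |W t| ≤ K) {T : ℝ}
    (hT : 1 ≤ T) : 5 / 2 ≤ (disc W T (-(K + 1 : ℝ) : ℂ)).re := by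
  set q : ℝ → ℝ := fun t => W t + (K + 1) with hqdef
  have hqc : Continuous q := by fun_prop
  have hq1 : ∀ t, 1 ≤ q t := fun t => by have := neg_le_of_abs_le (hWK t); simp [q]; linarith
  have hq0 : ∀ t, 0 ≤ q t := fun t => zero_le_one.trans (hq1 t)
  have hqe : (fun t => (W t : ℂ) - (-(K + 1 : ℝ) : ℂ)) = fun t => (q t : ℂ) := by
    funext t; simp [q]; ring
  have hqb : ∀ t, ‖(q t : ℂ)‖ ≤ 2 * K + 1 := fun t => by
    rw [Complex.norm_real, Real.norm_of_nonneg (hq0 t)]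
    have := le_of_abs_le (hWK t); simp [q]; linarith
  have hK : 1 ≤ 2 * K + 1 := by linarith [(abs_nonneg _).trans (hWK 0)]
  have hT0 : 0 ≤ T := by linarith
  unfold disc
  rw [hqe, Complex.add_re]
  have h1 : 1 ≤ (sol1 (fun t => (q t : ℂ)) 1 0 T).re := by
    have hs := pic_summable1 hK hqb 1 0 (by simp) (by simp) T
    rw [sol1, Complex.re_tsum hs]
    have := (Complex.hasSum_re hs.hasSum).summable.sum_le_tsum (Finset.range 1) (fun k _ => by
      obtain ⟨u, v, _, _, he, hp⟩ := pic_real hqc hq0 (a := 1) (b := 0) (by simp) (by simp) k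
      have he := he T
      simp only [Complex.ofReal_one, Complex.ofReal_zero] at he
      rw [he]; simpa using (hp T hT0).1)
    refine le_trans ?_ this
    simp [pic]
  have h2 : 3/2 ≤ (sol2 (fun t => (q t : ℂ)) 0 1 T).re := by
    have hs := pic_summable2 hK hqb 0 1 (by simp) (by simp) T
    rw [sol2, Complex.re_tsum hs]
    have := (Complex.hasSum_re hs.hasSum).summable.sum_le_tsum (Finset.range 3) (fun k _ => by
      obtain ⟨u, v, _, _, he, hp⟩ := pic_real hqc hq0 (a := 0) (b := 1) (by simp) (by simp) k
      have he := he T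
      simp only [Complex.ofReal_one, Complex.ofReal_zero] at he
      rw [he]; simpa using (hp T hT0).2)
    refine le_trans ?_ this
    rw [Finset.sum_range_succ, Finset.sum_range_succ, Finset.sum_range_one]
    have e2 : (pic (fun t => (q t : ℂ)) 0 1 2 T).2 = ((∫ t in (0:ℝ)..T, q t * t : ℝ) : ℂ) := by
      rw [← intervalIntegral.integral_ofReal]
      simp [pic]
    have e1 : (pic (fun t => (q t : ℂ)) 0 1 1 T).2 = 0 := by simp [pic]
    have e0 : (pic (fun t => (q t : ℂ)) 0 1 0 T).2 = 1 := by simp [pic]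
    rw [e0, e1, e2, Complex.ofReal_re]
    have : ∫ t in (0:ℝ)..T, t ≤ ∫ t in (0:ℝ)..T, q t * t := by
      apply intervalIntegral.integral_mono_on hT0
      · exact continuous_id.intervalIntegrable _ _
      · exact (hqc.mul continuous_id).intervalIntegrable _ _
      · intro t ht; exact le_mul_of_one_le_left ht.1 (hq1 t)
    rw [integral_id] at this
    simp
    nlinarith
  linarith

theorem disc_count (K R : ℝ) (hK : 0 ≤ K) (hR : 0 ≤ R) : ∃ C : ℝ, 0 ≤ C ∧
    ∀ (W : ℝ → ℝ) (T : ℝ), Continuous W → (∀ t, |W t| ≤ K) → 1 ≤ T →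
    ∀ s : Finset ℝ, (∀ x ∈ s, |x| ≤ R ∧ disc W T x ^ 2 = 4) → (s.card : ℝ) ≤ C * T := by
  set r : ℝ := R + K + 1 with hr
  set K' : ℝ := 5 * (R + K + 1) with hK'
  refine ⟨2 * (20 + 4 * K'), by positivity, ?_⟩
  intro W T hW hWK hT s hs
  set c : ℂ := (-(K + 1 : ℝ) : ℂ) with hc
  have hcn : ‖c‖ = K + 1 := by
    rw [hc, norm_neg, Complex.norm_real, Real.norm_of_nonneg (by linarith)]
  have h := zero_count c r (by positivity) (s.map ⟨_, Complex.ofReal_injective⟩)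
    (fun z => disc W T z ^ 2 - 4) (20 * Real.exp (4 * K' * T))
    (((disc_diff hW hWK T).pow 2).sub_const 4) ?_ ?_
  · rw [Finset.card_map] at h
    have hl := disc_lower hW hWK hT
    rw [← hc] at hl
    have h1 : 1 ≤ ‖disc W T c ^ 2 - 4‖ := by
      have h2 : 5/2 ≤ ‖disc W T c‖ := hl.trans (Complex.re_le_norm _)
      have h3 := norm_sub_norm_le (disc W T c ^ 2) 4
      rw [norm_pow] at h3
      have : ‖(4:ℂ)‖ = 4 := by simp
      nlinarith
    have h2 : (2:ℝ) ^ s.card ≤ 20 * Real.exp (4 * K' * T) := by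
      refine le_trans ?_ h
      exact le_mul_of_one_le_left (by positivity) h1
    have h3 : (s.card : ℝ) * Real.log 2 ≤ Real.log 20 + 4 * K' * T := by
      have := Real.log_le_log (by positivity) h2
      rwa [Real.log_pow, Real.log_mul (by norm_num) (Real.exp_ne_zero _), Real.log_exp] at this
    have h4 : Real.log 20 ≤ 20 := by
      have := Real.log_le_sub_one_of_pos (show (0:ℝ) < 20 by norm_num)
      linarith
    have h5 : 1/2 ≤ Real.log 2 := by linarith [Real.log_two_gt_d9]
    have h6 : (s.card : ℝ) * (1/2) ≤ (s.card : ℝ) * Real.log 2 := by gcongr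
    nlinarith
  · intro z hz
    have hzn : ‖z‖ ≤ 3 * r + (K + 1) := by
      have := norm_sub_norm_le z c
      rw [hcn] at this; linarith
    have := disc_upper hWK (by linarith : 0 ≤ T) K' (by simp [K']; linarith) z
      (by simp [K', r] at *; linarith)
    have h2 := norm_sub_le (disc W T z ^ 2) 4
    rw [norm_pow] at h2
    have h4 : ‖(4:ℂ)‖ = 4 := by simp
    have h5 : ‖disc W T z‖ ^ 2 ≤ (4 * Real.exp (2 * K' * T)) ^ 2 := by gcongr
    have h6 : (4 * Real.exp (2 * K' * T)) ^ 2 = 16 * Real.exp (4 * K' * T) := by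
      rw [mul_pow, ← Real.exp_nat_mul]; norm_num; ring_nf
    have h7 : 1 ≤ Real.exp (4 * K' * T) := Real.one_le_exp (by positivity)
    linarith
  · intro z hz
    simp only [Finset.mem_map, Function.Embedding.coeFn_mk] at hz
    obtain ⟨x, hx, rfl⟩ := hz
    obtain ⟨h1, h2⟩ := hs x hx
    refine ⟨?_, by rw [h2]; ring⟩
    refine (norm_sub_le _ _).trans ?_
    rw [hcn, Complex.norm_real, Real.norm_eq_abs]
    linarith

section sol
variable {𝕜 : Type*} [RCLike 𝕜]

structure IsSol (q y y1 : ℝ → 𝕜) : Prop where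
  d1 : ∀ x, HasDerivAt y (y1 x) x
  d2 : ∀ x, HasDerivAt y1 (q x * y x) x

theorem IsSol.wr {q y y1 w w1 : ℝ → 𝕜} (hy : IsSol q y y1) (hw : IsSol q w w1) (x : ℝ) :
    y x * w1 x - y1 x * w x = y 0 * w1 0 - y1 0 * w 0 := by
  have hd : ∀ x, HasDerivAt (fun x => y x * w1 x - y1 x * w x) 0 x := by
    intro x
    have := ((hy.d1 x).mul (hw.d2 x)).sub ((hy.d2 x).mul (hw.d1 x))
    convert! this using 1; ring
  exact is_const_of_deriv_eq_zero (fun x => (hd x).differentiableAt) (fun x => (hd x).deriv) x 0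

theorem IsSol.comb {q y y1 w w1 : ℝ → 𝕜} (hy : IsSol q y y1) (hw : IsSol q w w1) (a b : 𝕜) :
    IsSol q (fun x => a * y x + b * w x) (fun x => a * y1 x + b * w1 x) := by
  constructor
  · intro x; exact ((hy.d1 x).const_mul a).add ((hw.d1 x).const_mul b)
  · intro x
    convert! ((hy.d2 x).const_mul a).add ((hw.d2 x).const_mul b) using 1; ring

theorem IsSol.shift {q y y1 : ℝ → 𝕜} (hy : IsSol q y y1) {T : ℝ} (hq : Function.Periodic q T) :
    IsSol q (fun x => y (x + T)) (fun x => y1 (x + T)) := by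
  constructor
  · intro x; exact (hy.d1 (x + T)).comp_add_const x T
  · intro x
    have := (hy.d2 (x + T)).comp_add_const x T
    rwa [hq x] at this

structure Fund (q c c1 s s1 : ℝ → 𝕜) : Prop where
  hc : IsSol q c c1
  hs : IsSol q s s1
  c0 : c 0 = 1
  c10 : c1 0 = 0
  s0 : s 0 = 0
  s10 : s1 0 = 1

theorem Fund.wr {q c c1 s s1 : ℝ → 𝕜} (h : Fund q c c1 s s1) (x : ℝ) :
    c x * s1 x - c1 x * s x = 1 := by
  rw [h.hc.wr h.hs, h.c0, h.c10, h.s0, h.s10]; ring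

theorem Fund.repr {q c c1 s s1 y y1 : ℝ → 𝕜} (h : Fund q c c1 s s1) (hy : IsSol q y y1) (x : ℝ) :
    y x = y 0 * c x + y1 0 * s x ∧ y1 x = y 0 * c1 x + y1 0 * s1 x := by
  have h1 := hy.wr h.hs x
  have h2 := hy.wr h.hc x
  have h3 := h.wr x
  rw [h.s0, h.s10] at h1
  rw [h.c0, h.c10] at h2
  constructor
  · linear_combination (-y x) * h3 + c x * h1 - s x * h2
  · linear_combination (-y1 x) * h3 + c1 x * h1 - s1 x * h2

theorem Fund.floquet {q c c1 s s1 : ℝ → 𝕜} (h : Fund q c c1 s s1) {T : ℝ}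
    (hq : Function.Periodic q T) (z : 𝕜) (hz : z * z - (c T + s1 T) * z + 1 = 0) :
    ∃ y y1 : ℝ → 𝕜, IsSol q y y1 ∧ (∀ x, y (x + T) = z * y x) ∧ (∀ x, y1 (x + T) = z * y1 x) ∧
      (y 0 ≠ 0 ∨ y1 0 ≠ 0) := by
  have hw := h.wr T
  obtain ⟨a, b, hab, e1, e2⟩ : ∃ a b : 𝕜, (a ≠ 0 ∨ b ≠ 0) ∧ a * c T + b * s T = z * a ∧
      a * c1 T + b * s1 T = z * b := by
    by_cases h0 : s T ≠ 0 ∨ c T - z ≠ 0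
    · refine ⟨-s T, c T - z, ?_, by ring, ?_⟩
      · simpa using h0
      · linear_combination hw + hz
    · push Not at h0
      by_cases h4 : z - s1 T ≠ 0 ∨ c1 T ≠ 0
      · refine ⟨z - s1 T, c1 T, h4, ?_, by ring⟩
        linear_combination (z - s1 T) * h0.2 + c1 T * h0.1
      · push Not at h4
        refine ⟨1, 0, by simp, ?_, ?_⟩
        · linear_combination h0.2
        · linear_combination h4.2
  have hy := h.hc.comb h.hs a b
  have hsh := hy.shift hq
  refine ⟨_, _, hy, ?_, ?_, ?_⟩
  · intro x
    have := (h.repr hsh x).1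
    simp only [zero_add] at this
    rw [this, e1, e2]; ring
  · intro x
    have := (h.repr hsh x).2
    simp only [zero_add] at this
    rw [this, e1, e2]; ring
  · simpa [h.c0, h.c10, h.s0, h.s10] using hab
end sol

theorem fund_complex {q : ℝ → ℂ} (hq : Continuous q) {K : ℝ} (hK : ∀ t, ‖q t‖ ≤ K) :
    Fund q (sol1 q 1 0) (sol2 q 1 0) (sol1 q 0 1) (sol2 q 0 1) := by
  have hK' : ∀ t, ‖q t‖ ≤ K + 1 := fun t => (hK t).trans (by linarith)
  have h1 : 1 ≤ K + 1 := by linarith [(norm_nonneg _).trans (hK 0)]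
  exact ⟨⟨sol1_deriv h1 hK' 1 0 (by simp) (by simp) hq,
    sol2_deriv h1 hK' 1 0 (by simp) (by simp) hq⟩,
    ⟨sol1_deriv h1 hK' 0 1 (by simp) (by simp) hq,
    sol2_deriv h1 hK' 0 1 (by simp) (by simp) hq⟩, sol1_zero _ _ _, sol2_zero _ _ _,
    sol1_zero _ _ _, sol2_zero _ _ _⟩

theorem IsSol.re {q : ℝ → ℝ} {y y1 : ℝ → ℂ} (h : IsSol (fun t => (q t : ℂ)) y y1) :
    IsSol q (fun x => (y x).re) (fun x => (y1 x).re) := by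
  constructor
  · intro x
    exact (Complex.reCLM.hasFDerivAt.comp_hasDerivAt x (h.d1 x))
  · intro x
    have := (Complex.reCLM.hasFDerivAt.comp_hasDerivAt x (h.d2 x))
    convert! this using 1
    simp

theorem IsSol.ofReal {q y y1 : ℝ → ℝ} (h : IsSol q y y1) :
    IsSol (fun t => (q t : ℂ)) (fun x => (y x : ℂ)) (fun x => (y1 x : ℂ)) := by
  constructor
  · intro x; exact (h.d1 x).ofReal_comp
  · intro x
    have := (h.d2 x).ofReal_comp
    convert! this using 1
    simp

theorem fund_real {W : ℝ → ℝ} (hW : Continuous W) {K : ℝ} (hWK : ∀ t, |W t| ≤ K) (E : ℝ) :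
    ∃ c c1 s s1 : ℝ → ℝ, Fund (fun t => W t - E) c c1 s s1 ∧
      Fund (fun t => ((W t - E : ℝ) : ℂ)) (fun x => (c x : ℂ)) (fun x => (c1 x : ℂ))
        (fun x => (s x : ℂ)) (fun x => (s1 x : ℂ)) ∧
      ∀ T, disc W T E = ((c T + s1 T : ℝ) : ℂ) := by
  have hq : Continuous (fun t => ((W t - E : ℝ) : ℂ)) := by fun_prop
  have hF := fund_complex hq (K := K + |E|) (fun t => by
    rw [Complex.norm_real, Real.norm_eq_abs]
    exact (abs_sub _ _).trans (by linarith [hWK t]))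
  have hR : Fund (fun t => W t - E) _ _ _ _ :=
    ⟨hF.hc.re, hF.hs.re, by simp [sol1_zero], by simp [sol2_zero], by simp [sol1_zero], by simp [sol2_zero]⟩
  have hC : Fund (fun t => ((W t - E : ℝ) : ℂ)) _ _ _ _ :=
    ⟨hR.hc.ofReal, hR.hs.ofReal, by simp [sol1_zero], by simp [sol2_zero], by simp [sol1_zero],
      by simp [sol2_zero]⟩
  refine ⟨_, _, _, _, hR, hC, ?_⟩
  intro T
  have e1 := (hC.repr hF.hc T).1
  have e2 := (hC.repr hF.hs T).2
  rw [hF.c0, hF.c10] at e1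
  rw [hF.s0, hF.s10] at e2
  unfold disc
  push_cast at e1 e2 ⊢
  rw [e1, e2]; simp

/-- bounded Floquet solution in the elliptic case -/
theorem elliptic_sol {W : ℝ → ℝ} (hW : Continuous W) {K : ℝ} (hWK : ∀ t, |W t| ≤ K) {T : ℝ}
    (hper : Function.Periodic W T) (E : ℝ) (hD : ‖disc W T E‖ ≤ 2) :
    ∃ (z : ℂ) (y y1 : ℝ → ℂ), ‖z‖ = 1 ∧ IsSol (fun t => ((W t - E : ℝ) : ℂ)) y y1 ∧
      (∀ x, y (x + T) = z * y x) ∧ (∀ x, y1 (x + T) = z * y1 x) ∧ (y 0 ≠ 0 ∨ y1 0 ≠ 0) := by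
  obtain ⟨c, c1, s, s1, hR, hC, hd⟩ := fund_real hW hWK E
  rw [hd T, Complex.norm_real, Real.norm_eq_abs] at hD
  set D := c T + s1 T with hDdef
  have hD4 : 0 ≤ 4 - D ^ 2 := by nlinarith [sq_abs D, abs_nonneg D]
  set z : ℂ := ⟨D / 2, √(4 - D ^ 2) / 2⟩ with hz
  have hsq : √(4 - D^2) * √(4 - D^2) = 4 - D^2 := Real.mul_self_sqrt hD4
  have hnz : ‖z‖ = 1 := by
    have : ‖z‖ ^ 2 = 1 := by
      rw [← Complex.normSq_eq_norm_sq, Complex.normSq_mk]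
      nlinarith
    nlinarith [norm_nonneg z]
  have heq : z * z - ((c T : ℂ) + (s1 T : ℂ)) * z + 1 = 0 := by
    rw [← Complex.ofReal_add, ← hDdef]
    apply Complex.ext
    · simp [hz]; nlinarith
    · simp [hz]; nlinarith
  obtain ⟨y, y1, h1, h2, h3, h4⟩ := hC.floquet (T := T)
    (fun x => by simp [hper x]) z heq
  exact ⟨z, y, y1, hnz, h1, h2, h3, h4⟩

theorem periodic_bdd {f : ℝ → ℝ} (hf : Continuous f) {T : ℝ} (hT : 0 < T)
    (hp : ∀ x, |f (x + T)| = |f x|) : ∃ B, 0 < B ∧ ∀ x, |f x| ≤ B := by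
  have hp' : Function.Periodic (fun x => |f x|) T := hp
  obtain ⟨B, hB⟩ := (isCompact_Icc (a := (0:ℝ)) (b := T)).exists_bound_of_continuousOn
    hf.continuousOn
  refine ⟨|B| + 1, by positivity, fun x => ?_⟩
  obtain ⟨y, hy, he⟩ := hp'.exists_mem_Ico₀ hT x
  have he : |f x| = |f y| := he
  rw [he]
  have := hB y ⟨hy.1, hy.2.le⟩
  rw [Real.norm_eq_abs] at this
  linarith [le_abs_self B]

structure Hyp (q : ℝ → ℝ) (γ B : ℝ) (φ φ1 ψ ψ1 : ℝ → ℝ) : Prop where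
  γpos : 0 < γ
  Bpos : 0 < B
  hφ : IsSol q φ φ1
  hψ : IsSol q ψ ψ1
  bφ : ∀ x, |φ x| ≤ B * Real.exp (γ * x)
  bφ1 : ∀ x, |φ1 x| ≤ B * Real.exp (γ * x)
  bψ : ∀ x, |ψ x| ≤ B * Real.exp (-γ * x)
  bψ1 : ∀ x, |ψ1 x| ≤ B * Real.exp (-γ * x)
  wr : ∀ x, φ x * ψ1 x - φ1 x * ψ x = 1

theorem floquet_bound {f : ℝ → ℝ} (hf : Continuous f) {T : ℝ} (hT : 0 < T) (γ m : ℝ)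
    (hm : |m| = Real.exp (γ * T)) (hp : ∀ x, f (x + T) = m * f x) :
    ∃ B, 0 < B ∧ ∀ x, |f x| ≤ B * Real.exp (γ * x) := by
  have hp2 : ∀ x, |(fun x => Real.exp (-(γ * x)) * f x) (x + T)| =
      |(fun x => Real.exp (-(γ * x)) * f x) x| := by
    intro x
    simp only [abs_mul, Real.abs_exp, hp, hm]
    rw [← mul_assoc, ← Real.exp_add]; ring_nf
  have hcf : Continuous (fun x => Real.exp (-(γ * x)) * f x) := by fun_prop
  obtain ⟨B, hB, h⟩ := periodic_bdd hcf hT hp2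
  refine ⟨B, hB, fun x => ?_⟩
  have := h x
  rw [abs_mul, Real.abs_exp, Real.exp_neg, inv_mul_le_iff₀ (Real.exp_pos _)] at this
  linarith

theorem hyp_exists {W : ℝ → ℝ} (hW : Continuous W) {K : ℝ} (hWK : ∀ t, |W t| ≤ K) {T : ℝ}
    (hT : 0 < T) (hper : Function.Periodic W T) (E : ℝ) (hD : 2 < ‖disc W T E‖) :
    ∃ γ B φ φ1 ψ ψ1, Hyp (fun t => W t - E) γ B φ φ1 ψ ψ1 := by
  obtain ⟨c, c1, s, s1, hR, hC, hd⟩ := fund_real hW hWK E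
  rw [hd T, Complex.norm_real, Real.norm_eq_abs] at hD
  set D := c T + s1 T with hDdef
  have hq : Function.Periodic (fun t => W t - E) T := fun x => by simp [hper x]
  have hD4 : 0 < D ^ 2 - 4 := by nlinarith [sq_abs D, abs_nonneg D]
  obtain ⟨m, hm, hm1⟩ : ∃ m : ℝ, m * m - D * m + 1 = 0 ∧ 1 < |m| := by
    have hsq : √(D^2 - 4) * √(D^2 - 4) = D^2 - 4 := Real.mul_self_sqrt hD4.le
    have hs0 := Real.sqrt_nonneg (D^2-4)
    rcases le_total 0 D with h0 | h0
    · rw [abs_of_nonneg h0] at hD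
      refine ⟨(D + √(D^2-4))/2, by nlinarith, ?_⟩
      rw [abs_of_pos (by linarith)]; linarith
    · rw [abs_of_nonpos h0] at hD
      refine ⟨(D - √(D^2-4))/2, by nlinarith, ?_⟩
      rw [abs_of_neg (by linarith)]; linarith
  have hm0 : m ≠ 0 := by intro h; simp [h] at hm
  have hmi : m⁻¹ * m⁻¹ - D * m⁻¹ + 1 = 0 := by
    field_simp; linarith
  obtain ⟨φ, φ1, a1, a2, a3, a4⟩ := hR.floquet hq m hm
  obtain ⟨ψ, ψ1, b1, b2, b3, b4⟩ := hR.floquet hq m⁻¹ hmi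
  set γ := Real.log |m| / T with hγ
  have hγ0 : 0 < γ := div_pos (Real.log_pos hm1) hT
  have hγT : |m| = Real.exp (γ * T) := by
    rw [hγ, div_mul_cancel₀ _ hT.ne', Real.exp_log (by linarith)]
  have hγT' : |m⁻¹| = Real.exp (-γ * T) := by
    rw [abs_inv, hγT, ← Real.exp_neg]; ring_nf
  have cont : ∀ {y y1 : ℝ → ℝ}, IsSol (fun t => W t - E) y y1 → Continuous y ∧ Continuous y1 :=
    fun h => ⟨continuous_iff_continuousAt.2 fun x => (h.d1 x).continuousAt,
      continuous_iff_continuousAt.2 fun x => (h.d2 x).continuousAt⟩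
  set w := φ 0 * ψ1 0 - φ1 0 * ψ 0 with hw
  have hwx : ∀ x, φ x * ψ1 x - φ1 x * ψ x = w := fun x => a1.wr b1 x
  have hw0 : w ≠ 0 := by
    intro h0
    have hne : m ≠ m⁻¹ := by
      intro h
      have : |m| * |m| = 1 := by
        rw [← abs_mul]
        nth_rewrite 2 [h]
        rw [mul_inv_cancel₀ hm0]; simp
      nlinarith
    -- proportional: a φ + b ψ = 0
    have key : ∀ a b : ℝ, a * φ 0 + b * ψ 0 = 0 → a * φ1 0 + b * ψ1 0 = 0 → a = 0 := by
      intro a b e1 e2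
      have hr := fun x => hR.repr (a1.comb b1 a b) x
      simp only [e1, e2] at hr
      have hT1 := (hr T).1
      have hT2 := (hr T).2
      have f1 := a2 0
      have f2 := b2 0
      have f3 := a3 0
      have f4 := b3 0
      rw [zero_add] at f1 f2 f3 f4
      rw [f1, f2] at hT1
      rw [f3, f4] at hT2
      have g1 : (m - m⁻¹) * (a * φ 0) = 0 := by linear_combination hT1 - m⁻¹ * e1
      have g2 : (m - m⁻¹) * (a * φ1 0) = 0 := by linear_combination hT2 - m⁻¹ * e2
      have g0 : m - m⁻¹ ≠ 0 := sub_ne_zero.2 hne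
      rcases a4 with h | h
      · have := (mul_eq_zero.1 g1).resolve_left g0
        exact (mul_eq_zero.1 this).resolve_right h
      · have := (mul_eq_zero.1 g2).resolve_left g0
        exact (mul_eq_zero.1 this).resolve_right h
    rcases b4 with h | h
    · exact h (key (ψ 0) (-φ 0) (by ring) (by linarith))
    · exact h (key (ψ1 0) (-φ1 0) (by linarith) (by ring))
  obtain ⟨B1, hB1, p1⟩ := floquet_bound (cont a1).1 hT γ m hγT a2
  obtain ⟨B2, hB2, p2⟩ := floquet_bound (cont a1).2 hT γ m hγT a3
  have b' := b1.comb b1 w⁻¹ 0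
  simp only [zero_mul, add_zero] at b'
  obtain ⟨B3, hB3, p3⟩ := floquet_bound (cont b').1 hT (-γ) m⁻¹ hγT' (fun x => by rw [b2]; ring)
  obtain ⟨B4, hB4, p4⟩ := floquet_bound (cont b').2 hT (-γ) m⁻¹ hγT' (fun x => by rw [b3]; ring)
  refine ⟨γ, B1 + B2 + B3 + B4, φ, φ1, _, _, hγ0, by positivity, a1, b', ?_, ?_, ?_, ?_, ?_⟩
  · intro x; refine (p1 x).trans ?_; gcongr; linarith
  · intro x; refine (p2 x).trans ?_; gcongr; linarith
  · intro x; refine (p3 x).trans ?_; gcongr; linarith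
  · intro x; refine (p4 x).trans ?_; gcongr; linarith
  · intro x
    have := hwx x
    have h5 : w⁻¹ * w = 1 := inv_mul_cancel₀ hw0
    linear_combination h5 + w⁻¹ * this

theorem abstract_stab {X Y : Type*} [AddCommGroup X] [Module ℝ X] [AddCommGroup Y] [Module ℝ Y]
    (B : Y →ₗ[ℝ] Y →ₗ[ℝ] ℝ) (sym : ∀ f g, B f g = B g f) (pos : ∀ f, 0 ≤ B f f)
    (J A : X →ₗ[ℝ] Y) (hsym : ∀ u w, B (J u) (A w) = B (A u) (J w)) (r : ℝ) (hr0 : 0 ≤ r)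
    (hr : ∀ ε : ℝ, 0 < ε → ∃ u, 0 < B (J u) (J u) ∧ B (A u) (A u) ≤ (r^2 + ε) * B (J u) (J u))
    (hdense : ∀ m : ℝ, |m| ≤ r → (∃ c : ℝ, 0 < c ∧ ∀ u, c * B (J u) (J u) ≤
        B (A u - m • J u) (A u - m • J u)) →
      ∀ (g : Y) (η : ℝ), 0 < η → ∃ w, B (A w - m • J w - g) (A w - m • J w - g) < η) :
    ∃ m : ℝ, |m| ≤ r ∧ ∀ ε : ℝ, 0 < ε → ∃ u, B (A u - m • J u) (A u - m • J u)
      < ε * B (J u) (J u) := by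
  by_contra hcon
  push Not at hcon
  set S : Set ℝ := {ρ | ∃ u, B (J u) (J u) = 1 ∧ B (A u) (A u) = ρ} with hS
  have hnorm : ∀ u, 0 < B (J u) (J u) → B (A u) (A u) / B (J u) (J u) ∈ S := by
    intro u hu
    set n := B (J u) (J u) with hn
    have hs : √n * √n = n := Real.mul_self_sqrt hu.le
    have hs0 : √n ≠ 0 := (Real.sqrt_pos.2 hu).ne'
    refine ⟨(√n)⁻¹ • u, ?_, ?_⟩
    · simp only [map_smul, LinearMap.smul_apply, smul_eq_mul, ← hn]
      have hs2 : √n ^ 2 = n := by rw [sq, hs]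
      field_simp
      rw [hs2]
      try ring
    · simp only [map_smul, LinearMap.smul_apply, smul_eq_mul]
      have hs2 : √n ^ 2 = n := by rw [sq, hs]
      field_simp
      rw [hs2]
      try ring
  have hbb : BddBelow S := ⟨0, by rintro _ ⟨u, _, rfl⟩; exact pos _⟩
  set m2 := sInf S with hm2
  have hne : S.Nonempty := by
    obtain ⟨u, hu, _⟩ := hr 1 one_pos
    exact ⟨_, hnorm u hu⟩
  have hm20 : 0 ≤ m2 := le_csInf hne (by rintro _ ⟨u, _, rfl⟩; exact pos _)
  have hm2r : m2 ≤ r ^ 2 := by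
    apply le_of_forall_pos_le_add
    intro ε hε
    obtain ⟨u, hu, h⟩ := hr ε hε
    refine (csInf_le hbb (hnorm u hu)).trans ?_
    rwa [div_le_iff₀ hu]
  have hlow : ∀ u, m2 * B (J u) (J u) ≤ B (A u) (A u) := by
    intro u
    rcases (pos (J u)).eq_or_lt with h | h
    · rw [← h, mul_zero]; exact pos _
    · rw [← le_div_iff₀ h]; exact csInf_le hbb (hnorm u h)
  set m := √m2 with hm
  have hmm : m * m = m2 := Real.mul_self_sqrt hm20
  have hm0 : 0 ≤ m := Real.sqrt_nonneg _
  have hmr : m ≤ r := Real.sqrt_le_iff.2 ⟨hr0, hm2r⟩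
  have hneg : |(-m)| ≤ r := by rw [abs_neg, abs_of_nonneg hm0]; exact hmr
  have hpos' : |m| ≤ r := by rw [abs_of_nonneg hm0]; exact hmr
  obtain ⟨c, hc, hcu⟩ := hcon (-m) hneg
  obtain ⟨e, he, heu⟩ := hcon m hpos'
  have hd := hdense m hpos' ⟨e, he, heu⟩
  set G := 4 * m2 + 2 with hG
  set Kc := (2 * G + 2) * (2 + 2 * m2 / e) with hKc
  have hKc0 : 0 < Kc := by positivity
  set η := min 1 (min (c/2) (c^2/(32*Kc))) with hη
  have hη0 : 0 < η := by positivity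
  have hη1 : η ≤ 1 := min_le_left _ _
  have hη2 : η ≤ c/2 := (min_le_right _ _).trans (min_le_left _ _)
  have hη3 : η ≤ c^2/(32*Kc) := (min_le_right _ _).trans (min_le_right _ _)
  rw [le_div_iff₀ (by positivity)] at hη3
  obtain ⟨_, ⟨u, hu1, rfl⟩, hu2⟩ := exists_lt_of_csInf_lt hne (show sInf S < m2 + η by linarith)
  obtain ⟨w, hw⟩ := hd (A u + m • J u) η hη0
  have hg := hcu u
  have hh := heu w
  have hab : ∀ t : ℝ, 0 ≤ B (A (u + t • w)) (A (u + t • w)) -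
      m2 * B (J (u + t • w)) (J (u + t • w)) := fun t => sub_nonneg.2 (hlow _)
  have p0 := pos (J w)
  have p1 := pos (A u - m • J u)
  have p2 := pos ((A w - m • J w) - m • J w)
  have p3 := pos ((A w - m • J w) + (-2 : ℝ) • (A u + m • J u))
  simp only [map_add, map_sub, map_smul, LinearMap.add_apply, LinearMap.sub_apply,
    LinearMap.smul_apply, smul_eq_mul] at hg hh hw hab p1 p2 p3
  have s1 := sym (J u) (A u)
  have s2 := sym (J u) (A w)
  have s3 := sym (J u) (J w)
  have s4 := sym (J w) (A w)
  have s5 := sym (J w) (A u)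
  have s6 := sym (A w) (A u)
  have s7 := hsym u w
  rw [s7] at s2
  simp only [s1, s7, s3, s4, s5, s6, ← s2, hu1] at hg hh hw hab p1 p2 p3
  generalize B (A u) (A u) = uu at *
  generalize B (A u) (J u) = uj at *
  generalize B (A u) (A w) = uw at *
  generalize B (A u) (J w) = ujw at *
  generalize B (J w) (J u) = jj at *
  generalize B (A w) (A w) = ww at *
  generalize B (A w) (J w) = wj at *
  generalize B (J w) (J w) = jw at *
  have q1 : 0 ≤ uu - 2 * m * uj + m2 := le_of_le_of_eq p1 (by linear_combination hmm)
  have q2 : 0 ≤ ww - 4 * m * wj + 4 * m2 * jw := le_of_le_of_eq p2 (by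
    linear_combination 4 * jw * hmm)
  have q3 : 0 ≤ (ww - 2 * m * wj + m2 * jw) - 4 * (uw - m2 * jj) + 4 * (uu + 2 * m * uj + m2) :=
    le_of_le_of_eq p3 (by linear_combination (jw + 4 * jj + 4) * hmm)
  have q4 : (ww - 2 * m * wj + m2 * jw) - 2 * (uw - m2 * jj) + (uu + 2 * m * uj + m2) < η :=
    lt_of_eq_of_lt (by linear_combination (-jw - 2 * jj - 1) * hmm) hw
  have q5 : c ≤ uu + 2 * m * uj + m2 := by
    have := le_of_le_of_eq hg (show _ = uu + 2 * m * uj + m2 by linear_combination hmm)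
    linarith
  have q6 : e * jw ≤ ww - 2 * m * wj + m2 * jw :=
    le_of_le_of_eq hh (by linear_combination jw * hmm)
  have q7 : ∀ t : ℝ, 0 ≤ (uu - m2) + 2 * t * (uw - m2 * jj) + t^2 * (ww - m2 * jw) := fun t =>
    le_of_le_of_eq (hab t) (by ring)
  set Nh := ww - 2 * m * wj + m2 * jw with hNh
  set Ng := uu + 2 * m * uj + m2 with hNg
  set b := uw - m2 * jj with hb
  have r1 : Ng ≤ G := by rw [hNg, hG]; linarith
  have r2 : Nh ≤ 2 * G + 2 := by linarith
  have r3 : jw ≤ (2 * G + 2) / e := by rw [le_div_iff₀ he]; linarith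
  have hjw0 : 0 ≤ jw := by assumption
  have r4 : ww ≤ Kc := by
    have h1 : m2 * jw ≤ m2 * ((2 * G + 2) / e) := by gcongr
    have h2 : Kc = 2 * (2 * G + 2) + 2 * (m2 * ((2 * G + 2) / e)) := by
      rw [hKc]; ring
    rw [h2]; linarith
  have r5 : ww - m2 * jw ≤ Kc := by linarith [mul_nonneg hm20 hjw0]
  have r6 : c / 4 ≤ b := by
    have : 0 ≤ Nh := by linarith [mul_nonneg he.le hjw0]
    linarith
  have r7 := q7 (-b / Kc)
  have r8 : (-b / Kc)^2 * (ww - m2 * jw) ≤ (-b/Kc)^2 * Kc := by gcongr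
  have r9 : (-b / Kc)^2 * Kc = b^2 / Kc := by field_simp
  have r10 : 2 * (-b / Kc) * b = -2 * (b^2 / Kc) := by field_simp
  have r11 : b^2 / Kc ≤ η := by linarith
  rw [div_le_iff₀ hKc0] at r11
  have r12 : (c/4)^2 ≤ b^2 := by gcongr
  have r13 : (c/4)^2 = c^2/16 := by ring
  have r14 : 0 < c^2 := by positivity
  linarith

section c2
variable {F : Type*} [NormedAddCommGroup F] [NormedSpace ℝ F]

theorem c2_of {u u1 u2 : ℝ → F} (h1 : ∀ x, HasDerivAt u (u1 x) x)
    (h2 : ∀ x, HasDerivAt u1 (u2 x) x) (h3 : Continuous u2) :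
    ContDiff ℝ 2 u ∧ deriv (deriv u) = u2 := by
  have e1 : deriv u = u1 := funext fun x => (h1 x).deriv
  have e2 : deriv u1 = u2 := funext fun x => (h2 x).deriv
  refine ⟨?_, by rw [e1, e2]⟩
  rw [show (2 : WithTop ℕ∞) = 1 + 1 from (one_add_one_eq_two).symm, contDiff_succ_iff_deriv]
  refine ⟨fun x => (h1 x).differentiableAt, by simp, ?_⟩
  rw [e1, contDiff_one_iff_deriv, e2]
  exact ⟨fun x => (h2 x).differentiableAt, h3⟩

theorem c2_to {u : ℝ → F} (h : ContDiff ℝ 2 u) :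
    (∀ x, HasDerivAt u (deriv u x) x) ∧ (∀ x, HasDerivAt (deriv u) (deriv (deriv u) x) x) ∧
    Continuous u ∧ Continuous (deriv u) ∧ Continuous (deriv (deriv u)) := by
  rw [show (2 : WithTop ℕ∞) = 1 + 1 from (one_add_one_eq_two).symm, contDiff_succ_iff_deriv] at h
  obtain ⟨h1, -, h2⟩ := h
  rw [contDiff_one_iff_deriv] at h2
  exact ⟨fun x => (h1 x).hasDerivAt, fun x => (h2.1 x).hasDerivAt, h1.continuous,
    h2.1.continuous, h2.2⟩
end c2

def Hf (q u : ℝ → ℝ) : ℝ → ℝ := fun x => -deriv (deriv u) x + q x * u x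

def Tst (u : ℝ → ℝ) : Prop := ContDiff ℝ 2 u ∧ HasCompactSupport u
def Cs (u : ℝ → ℝ) : Prop := Continuous u ∧ HasCompactSupport u

theorem Tst.cs {u : ℝ → ℝ} (h : Tst u) : Cs u := ⟨h.1.continuous, h.2⟩

theorem Tst.cs1 {u : ℝ → ℝ} (h : Tst u) : Cs (deriv u) := ⟨(c2_to h.1).2.2.2.1, h.2.deriv⟩

theorem Tst.cs2 {u : ℝ → ℝ} (h : Tst u) : Cs (deriv (deriv u)) :=
  ⟨(c2_to h.1).2.2.2.2, h.2.deriv.deriv⟩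

theorem Cs.mul {f g : ℝ → ℝ} (hf : Continuous f) (hg : Cs g) : Cs (fun x => f x * g x) :=
  ⟨hf.mul hg.1, hg.2.mul_left⟩

theorem Cs.add {f g : ℝ → ℝ} (hf : Cs f) (hg : Cs g) : Cs (fun x => f x + g x) :=
  ⟨hf.1.add hg.1, hf.2.add hg.2⟩

theorem Cs.int {f : ℝ → ℝ} (hf : Cs f) : Integrable f :=
  hf.1.integrable_of_hasCompactSupport hf.2

theorem Tst.hf {q u : ℝ → ℝ} (hq : Continuous q) (h : Tst u) : Cs (Hf q u) := by
  have h1 := (Cs.mul (f := fun _ => -1) continuous_const h.cs2).add (Cs.mul hq h.cs)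
  have : Hf q u = (fun x => -1 * deriv (deriv u) x + q x * u x) := by
    funext x; simp [Hf]
  rw [this]; exact h1

theorem Cs.sq {f : ℝ → ℝ} (hf : Cs f) : Integrable (fun x => f x ^ 2) := by
  have := (Cs.mul hf.1 hf).int
  simpa [pow_two] using this

def RS (W : ℝ → ℝ) : Set ℝ := {E | ∀ ε : ℝ, 0 < ε → ∃ u, Tst u ∧
  ∫ x, Hf (fun x => W x - E) u x ^ 2 < ε * ∫ x, u x ^ 2}

theorem split_real {W : ℝ → ℝ} (hW : Continuous W) {E ε : ℝ} {u : ℝ → ℂ} (hu : ContDiff ℝ 2 u)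
    (hcs : HasCompactSupport u)
    (h : (∫ x : ℝ, ‖-deriv (deriv u) x + (W x : ℂ) * u x - (E : ℂ) * u x‖ ^ 2) <
      ε * ∫ x, ‖u x‖ ^ 2) :
    ∃ v, Tst v ∧ ∫ x, Hf (fun x => W x - E) v x ^ 2 < ε * ∫ x, v x ^ 2 := by
  have hc := c2_to hu
  have main : ∀ L : ℂ →L[ℝ] ℝ, Tst (fun x => L (u x)) ∧
      ∀ x, deriv (deriv (fun x => L (u x))) x = L (deriv (deriv u) x) := by
    intro L
    have h1 : ∀ x, HasDerivAt (fun x => L (u x)) (L (deriv u x)) x := fun x =>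
      L.hasFDerivAt.comp_hasDerivAt x (hc.1 x)
    have h2 : ∀ x, HasDerivAt (fun x => L (deriv u x)) (L (deriv (deriv u) x)) x := fun x =>
      L.hasFDerivAt.comp_hasDerivAt x (hc.2.1 x)
    obtain ⟨e1, e2⟩ := c2_of h1 h2 (L.continuous.comp hc.2.2.2.2)
    refine ⟨⟨e1, ?_⟩, fun x => by rw [e2]⟩
    exact hcs.comp_left (map_zero L)
  obtain ⟨a1, a2⟩ := main Complex.reCLM
  obtain ⟨b1, b2⟩ := main Complex.imCLM
  have hq : Continuous (fun x => W x - E) := by fun_prop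
  set v := (fun x => Complex.reCLM (u x)) with hv
  set w := (fun x => Complex.imCLM (u x)) with hw
  have e1 : (∫ x, ‖u x‖ ^ 2) = (∫ x, v x ^ 2) + ∫ x, w x ^ 2 := by
    rw [← integral_add a1.cs.sq b1.cs.sq]
    congr 1; funext x
    rw [← Complex.normSq_eq_norm_sq, Complex.normSq_apply]; simp [v, w]; ring
  have e2 : (∫ x : ℝ, ‖-deriv (deriv u) x + (W x : ℂ) * u x - (E : ℂ) * u x‖ ^ 2) =
      (∫ x, Hf (fun x => W x - E) v x ^ 2) + ∫ x, Hf (fun x => W x - E) w x ^ 2 := by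
    rw [← integral_add (a1.hf hq).sq (b1.hf hq).sq]
    congr 1; funext x
    rw [← Complex.normSq_eq_norm_sq, Complex.normSq_apply]
    simp only [Hf, a2, b2]
    simp [v, w]; ring
  rw [e1, e2] at h
  by_contra hcon
  push Not at hcon
  have h1 := hcon v a1
  have h2 := hcon w b1
  linarith

theorem spec_iff {W : ℝ → ℝ} (hW : Continuous W) : schrodingerSpectrum W = RS W := by
  ext E
  constructor
  · intro h ε hε
    obtain ⟨u, hu, hcs, h1, h2⟩ := h ε hε
    exact split_real hW hu hcs (by rw [h1, mul_one]; exact h2)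
  · intro h ε hε
    obtain ⟨u, hu, h1⟩ := h ε hε
    set n := ∫ x, u x ^ 2 with hn
    have hf0 : 0 ≤ ∫ x, Hf (fun x => W x - E) u x ^ 2 := integral_nonneg fun x => sq_nonneg _
    have hn0 : 0 < n := by
      have : 0 < ε * n := lt_of_le_of_lt hf0 h1
      exact (pos_iff_pos_of_mul_pos this).1 hε
    have hs : √n ^ 2 = n := Real.sq_sqrt hn0.le
    set k := (√n)⁻¹ with hk
    have hk2 : k ^ 2 * n = 1 := by
      rw [hk, inv_pow, hs]; exact inv_mul_cancel₀ hn0.ne'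
    have hc := c2_to hu.1
    have d1 : ∀ x, HasDerivAt (fun x => ((k * u x : ℝ) : ℂ)) ((k * deriv u x : ℝ) : ℂ) x :=
      fun x => ((hc.1 x).const_mul k).ofReal_comp
    have d2 : ∀ x, HasDerivAt (fun x => ((k * deriv u x : ℝ) : ℂ))
        ((k * deriv (deriv u) x : ℝ) : ℂ) x :=
      fun x => ((hc.2.1 x).const_mul k).ofReal_comp
    obtain ⟨e1, e2⟩ := c2_of d1 d2
      (Complex.continuous_ofReal.comp (continuous_const.mul hc.2.2.2.2))
    refine ⟨_, e1, ?_, ?_, ?_⟩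
    · exact hu.2.comp_left (g := fun y => ((k * y : ℝ) : ℂ)) (by simp)
    · have : ∀ x, ‖((k * u x : ℝ) : ℂ)‖ ^ 2 = k ^ 2 * u x ^ 2 := by
        intro x; rw [Complex.norm_real, Real.norm_eq_abs, sq_abs]; ring
      simp_rw [this]
      rw [integral_const_mul, ← hn, hk2]
    · rw [e2]
      have : ∀ x, ‖-((k * deriv (deriv u) x : ℝ) : ℂ) + (W x : ℂ) * ((k * u x : ℝ) : ℂ) -
          (E : ℂ) * ((k * u x : ℝ) : ℂ)‖ ^ 2 = k ^ 2 * Hf (fun x => W x - E) u x ^ 2 := by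
        intro x
        rw [show -((k * deriv (deriv u) x : ℝ) : ℂ) + (W x : ℂ) * ((k * u x : ℝ) : ℂ) -
          (E : ℂ) * ((k * u x : ℝ) : ℂ) = ((k * Hf (fun x => W x - E) u x : ℝ) : ℂ) by
            simp only [Hf]; push_cast; ring]
        rw [Complex.norm_real, Real.norm_eq_abs, sq_abs]; ring
      simp_rw [this]
      rw [integral_const_mul]
      have hk0 : 0 < k ^ 2 := by
        rw [hk]; have := Real.sqrt_pos.2 hn0; positivity
      calc _ < k ^ 2 * (ε * n) := by gcongr
        _ = ε * (k ^ 2 * n) := by ring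
        _ = ε := by rw [hk2, mul_one]

def CcSub : Submodule ℝ (ℝ → ℝ) where
  carrier := {f | Cs f}
  add_mem' := fun ha hb => Cs.add ha hb
  zero_mem' := ⟨continuous_const, HasCompactSupport.zero⟩
  smul_mem' := fun c f hf => Cs.mul (f := fun _ => c) continuous_const hf

def TstSub : Submodule ℝ (ℝ → ℝ) where
  carrier := {f | Tst f}
  add_mem' := fun ha hb => ⟨ha.1.add hb.1, ha.2.add hb.2⟩
  zero_mem' := ⟨contDiff_const, HasCompactSupport.zero⟩
  smul_mem' := fun c f hf => ⟨contDiff_const.smul hf.1, hf.2.smul_left (f := fun _ => c)⟩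

theorem Hf_add {q u v : ℝ → ℝ} (hu : Tst u) (hv : Tst v) :
    Hf q (u + v) = Hf q u + Hf q v := by
  have h1 := c2_to hu.1
  have h2 := c2_to hv.1
  have := (c2_of (fun x => (h1.1 x).add (h2.1 x)) (fun x => (h1.2.1 x).add (h2.2.1 x))
    (h1.2.2.2.2.add h2.2.2.2.2)).2
  funext x
  have := congrFun this x
  simp only [Hf, Pi.add_apply] at this ⊢
  rw [this]; ring

theorem Hf_smul {q u : ℝ → ℝ} (k : ℝ) (hu : Tst u) :
    Hf q (k • u) = k • Hf q u := by
  have h1 := c2_to hu.1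
  have := (c2_of (fun x => (h1.1 x).const_mul k) (fun x => (h1.2.1 x).const_mul k)
    (continuous_const.mul h1.2.2.2.2)).2
  funext x
  have := congrFun this x
  have e : (k • u) = fun x => k * u x := rfl
  rw [← e] at this
  simp only [Hf, Pi.smul_apply, smul_eq_mul] at this ⊢
  rw [this]; ring

def Bf : CcSub →ₗ[ℝ] CcSub →ₗ[ℝ] ℝ :=
  LinearMap.mk₂ ℝ (fun f g => ∫ x, f.1 x * g.1 x)
    (fun f f' g => by
      rw [← integral_add (Cs.mul f.2.1 g.2).int (Cs.mul f'.2.1 g.2).int]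
      congr 1; funext x; simp [add_mul])
    (fun c f g => by
      rw [smul_eq_mul, ← integral_const_mul]
      congr 1; funext x; simp [mul_assoc])
    (fun f g g' => by
      rw [← integral_add (Cs.mul f.2.1 g.2).int (Cs.mul f.2.1 g'.2).int]
      congr 1; funext x; simp [mul_add])
    (fun c f g => by
      rw [smul_eq_mul, ← integral_const_mul]
      congr 1; funext x; simp; ring)

def Jf : TstSub →ₗ[ℝ] CcSub where
  toFun u := ⟨u.1, Tst.cs u.2⟩
  map_add' _ _ := rfl
  map_smul' _ _ := rfl

def Af (q : ℝ → ℝ) (hq : Continuous q) : TstSub →ₗ[ℝ] CcSub where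
  toFun u := ⟨Hf q u.1, Tst.hf hq u.2⟩
  map_add' u v := Subtype.ext (Hf_add u.2 v.2)
  map_smul' c u := Subtype.ext (Hf_smul c u.2)

theorem Hf_sym {q u w : ℝ → ℝ} (hq : Continuous q) (hu : Tst u) (hw : Tst w) :
    ∫ x, u x * Hf q w x = ∫ x, Hf q u x * w x := by
  have h1 := c2_to hu.1
  have h2 := c2_to hw.1
  have key : ∫ x, (u x * Hf q w x - Hf q u x * w x) = 0 := by
    apply integral_eq_zero_of_hasDerivAt_of_integrable
      (f := fun x => deriv u x * w x - u x * deriv w x)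
    · intro x
      convert! ((h1.2.1 x).mul (h2.1 x)).sub ((h1.1 x).mul (h2.2.1 x)) using 1
      simp only [Hf]; ring
    · exact (Cs.mul hu.cs.1 (hw.hf hq)).int.sub (Cs.mul (hu.hf hq).1 hw.cs).int
    · exact (Cs.mul hu.cs1.1 hw.cs).int.sub (Cs.mul hu.cs.1 hw.cs1).int
  rw [integral_sub (Cs.mul hu.cs.1 (hw.hf hq)).int (Cs.mul (hu.hf hq).1 hw.cs).int] at key
  linarith

theorem stab_aux {W : ℝ → ℝ} (hW : Continuous W) (E r : ℝ) (hr0 : 0 ≤ r)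
    (hr : ∀ ε : ℝ, 0 < ε → ∃ u, Tst u ∧ 0 < (∫ x, u x ^ 2) ∧
      ∫ x, Hf (fun x => W x - E) u x ^ 2 ≤ (r^2 + ε) * ∫ x, u x ^ 2)
    (hdense : ∀ E', E' ∉ RS W → ∀ g, Cs g → ∀ η : ℝ, 0 < η → ∃ w, Tst w ∧
      ∫ x, (Hf (fun x => W x - E') w x - g x) ^ 2 < η) :
    ∃ E' ∈ RS W, |E' - E| ≤ r := by
  have hq : Continuous (fun x => W x - E) := by fun_prop
  have hJ : ∀ u : TstSub, Bf (Jf u) (Jf u) = ∫ x, u.1 x ^ 2 := fun u => by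
    show ∫ x, u.1 x * u.1 x = _
    simp only [pow_two]
  have hA : ∀ u : TstSub, Bf (Af _ hq u) (Af _ hq u) = ∫ x, Hf (fun x => W x - E) u.1 x ^ 2 :=
    fun u => by
      show ∫ x, Hf (fun x => W x - E) u.1 x * Hf (fun x => W x - E) u.1 x = _
      simp only [pow_two]
  have hAm : ∀ (m : ℝ) (u : TstSub), Bf (Af _ hq u - m • Jf u) (Af _ hq u - m • Jf u) =
      ∫ x, Hf (fun x => W x - (E + m)) u.1 x ^ 2 := fun m u => by
    show ∫ x, (Hf (fun x => W x - E) u.1 x - m * u.1 x) * (Hf (fun x => W x - E) u.1 x - m * u.1 x) = _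
    congr 1; funext x; simp only [Hf]; ring
  have hAg : ∀ (m : ℝ) (u : TstSub) (g : CcSub), Bf (Af _ hq u - m • Jf u - g)
      (Af _ hq u - m • Jf u - g) =
      ∫ x, (Hf (fun x => W x - (E + m)) u.1 x - g.1 x) ^ 2 := fun m u g => by
    show ∫ x, (Hf (fun x => W x - E) u.1 x - m * u.1 x - g.1 x) * (Hf (fun x => W x - E) u.1 x - m * u.1 x - g.1 x) = _
    congr 1; funext x; simp only [Hf]; ring
  obtain ⟨m, hm, h⟩ := abstract_stab Bf
    (fun f g => by show ∫ x, f.1 x * g.1 x = ∫ x, g.1 x * f.1 x; simp only [mul_comm])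
    (fun f => by show 0 ≤ ∫ x, f.1 x * f.1 x; exact integral_nonneg fun x => mul_self_nonneg _)
    Jf (Af _ hq) (fun u w => Hf_sym hq u.2 w.2) r hr0
    (fun ε hε => by
      obtain ⟨u, hu, h1, h2⟩ := hr ε hε
      exact ⟨⟨u, hu⟩, by rw [hJ]; exact h1, by rw [hJ, hA]; exact h2⟩)
    (fun m _ hc g η hη => by
      have hn : E + m ∉ RS W := by
        intro h
        obtain ⟨c, hc0, hc⟩ := hc
        obtain ⟨u, hu, h1⟩ := h c hc0
        have := hc ⟨u, hu⟩
        rw [hJ, hAm] at this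
        exact absurd h1 (not_lt.2 this)
      obtain ⟨w, hw, h1⟩ := hdense _ hn g.1 g.2 η hη
      exact ⟨⟨w, hw⟩, by rw [hAg]; exact h1⟩)
  refine ⟨E + m, fun ε hε => ?_, by simpa using hm⟩
  obtain ⟨u, hu⟩ := h ε hε
  rw [hJ, hAm] at hu
  exact ⟨u.1, u.2, hu⟩

theorem cutoff_exists : ∃ (χ χ1 χ2 : ℝ → ℝ) (C : ℝ), (∀ x, HasDerivAt χ (χ1 x) x) ∧
    (∀ x, HasDerivAt χ1 (χ2 x) x) ∧ Continuous χ2 ∧ (∀ x, |x| ≤ 1 → χ x = 1) ∧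
    (∀ x, 2 ≤ |x| → χ x = 0 ∧ χ1 x = 0 ∧ χ2 x = 0) ∧ (∀ x, |χ x| ≤ 1) ∧ (∀ x, |χ1 x| ≤ C) ∧
    (∀ x, |χ2 x| ≤ C) := by
  let f : ContDiffBump (0:ℝ) := ⟨1, 2, one_pos, one_lt_two⟩
  have hf : ContDiff ℝ 2 (f : ℝ → ℝ) := f.contDiff
  have hc := c2_to hf
  have hcs : HasCompactSupport (f : ℝ → ℝ) := f.hasCompactSupport
  obtain ⟨C1, h1⟩ := hcs.deriv.exists_bound_of_continuous hc.2.2.2.1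
  obtain ⟨C2, h2⟩ := hcs.deriv.deriv.exists_bound_of_continuous hc.2.2.2.2
  have out0 : ∀ x : ℝ, 2 ≤ |x| → f x = 0 := fun x hx => f.zero_of_le_dist (by simpa using hx)
  have aux : ∀ h h1 : ℝ → ℝ, (∀ x, HasDerivAt h (h1 x) x) → Continuous h1 →
      (∀ x : ℝ, 2 ≤ |x| → h x = 0) → (∀ x : ℝ, 2 ≤ |x| → h1 x = 0) := by
    intro h h1 hd hcont h0 x hx
    have hcl : IsClosed {x | h1 x = 0} := isClosed_eq hcont continuous_const
    have hopen : ∀ x : ℝ, 2 < |x| → h1 x = 0 := by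
      intro x hx
      have : h =ᶠ[nhds x] fun _ => 0 := by
        filter_upwards [(isOpen_lt continuous_const continuous_abs).mem_nhds hx] with y hy
        exact h0 y (le_of_lt hy)
      exact (hd x).unique ((hasDerivAt_const x (0:ℝ)).congr_of_eventuallyEq this)
    have hl : Tendsto (fun t : ℝ => h1 (x + t * x)) (nhdsWithin 0 (Ioi 0)) (nhds (h1 (x + 0 * x))) :=
      ((hcont.comp (by fun_prop : Continuous fun t : ℝ => x + t * x)).tendsto 0).mono_left
        nhdsWithin_le_nhds
    have hz : Tendsto (fun t : ℝ => h1 (x + t * x)) (nhdsWithin 0 (Ioi 0)) (nhds 0) := by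
      refine tendsto_const_nhds.congr' ?_
      filter_upwards [self_mem_nhdsWithin] with t ht
      have ht : 0 < t := ht
      refine (hopen _ ?_).symm
      rw [show x + t * x = (1+t) * x by ring, abs_mul, abs_of_pos (by linarith : 0 < 1 + t)]
      nlinarith
    have := tendsto_nhds_unique hl hz
    simpa using this
  have o1 := aux _ _ hc.1 hc.2.2.2.1 out0
  have o2 := aux _ _ hc.2.1 hc.2.2.2.2 o1
  refine ⟨f, _, _, max C1 C2, hc.1, hc.2.1, hc.2.2.2.2, ?_, fun x hx => ⟨out0 x hx, o1 x hx, o2 x hx⟩,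
    ?_, fun x => (h1 x).trans (le_max_left _ _), fun x => (h2 x).trans (le_max_right _ _)⟩
  · intro x hx
    exact f.one_of_mem_closedBall (by simpa using hx)
  · intro x
    rw [abs_of_nonneg f.nonneg]; exact f.le_one

theorem cut {F : Type*} [NormedAddCommGroup F] [NormedSpace ℝ F] {y y1 y2 : ℝ → F} {M : ℝ}
    (d1 : ∀ x, HasDerivAt y (y1 x) x) (d2 : ∀ x, HasDerivAt y1 (y2 x) x) (hc : Continuous y2)
    (hy : ∀ x, ‖y x‖ ≤ M) (hy1 : ∀ x, ‖y1 x‖ ≤ M) :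
    ∃ K : ℝ, ∀ L : ℝ, 1 ≤ L → ∃ (u : ℝ → F) (k : ℝ → ℝ) (e : ℝ → F),
      ContDiff ℝ 2 u ∧ HasCompactSupport u ∧ (∀ x, u x = k x • y x) ∧
      (∀ x, deriv (deriv u) x = k x • y2 x + e x) ∧
      (∀ x, |x| ≤ L → k x = 1) ∧ ∫ x, ‖e x‖ ^ 2 ≤ K / L := by
  obtain ⟨χ, χ1, χ2, C, c1, c2, cc, cin, cout, cb, cb1, cb2⟩ := cutoff_exists
  have hM : 0 ≤ M := (norm_nonneg _).trans (hy 0)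
  have hC : 0 ≤ C := (abs_nonneg _).trans (cb1 0)
  refine ⟨36 * (C * M) ^ 2, fun L hL => ?_⟩
  have hL0 : 0 < L := by linarith
  have s1 : ∀ x, HasDerivAt (fun x => χ (x / L)) (χ1 (x / L) / L) x := fun x => by
    have := (c1 (x / L)).comp x ((hasDerivAt_id x).div_const L)
    convert! this using 1; ring
  have s2 : ∀ x, HasDerivAt (fun x => χ1 (x / L) / L) (χ2 (x / L) / L / L) x := fun x => by
    have := ((c2 (x / L)).comp x ((hasDerivAt_id x).div_const L)).div_const L
    convert! this using 1; ring
  have hyc : Continuous y := continuous_iff_continuousAt.2 fun x => (d1 x).continuousAt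
  have hy1c : Continuous y1 := continuous_iff_continuousAt.2 fun x => (d2 x).continuousAt
  have hk : Continuous (fun x => χ (x / L)) :=
    continuous_iff_continuousAt.2 fun x => (s1 x).continuousAt
  have hk1 : Continuous (fun x => χ1 (x / L) / L) :=
    continuous_iff_continuousAt.2 fun x => (s2 x).continuousAt
  have hk2 : Continuous (fun x => χ2 (x / L) / L / L) := by fun_prop
  let e : ℝ → F := fun x => (2 * (χ1 (x / L) / L)) • y1 x + (χ2 (x / L) / L / L) • y x
  have D1 : ∀ x, HasDerivAt (fun x => χ (x / L) • y x)
      (χ (x / L) • y1 x + (χ1 (x / L) / L) • y x) x := fun x => (s1 x).smul (d1 x)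
  have D2 : ∀ x, HasDerivAt (fun x => χ (x / L) • y1 x + (χ1 (x / L) / L) • y x)
      (χ (x / L) • y2 x + e x) x := fun x => by
    convert! ((s1 x).smul (d2 x)).add ((s2 x).smul (d1 x)) using 1
    simp only [e]; module
  have hec : Continuous e :=
    ((continuous_const.mul hk1).smul hy1c).add (hk2.smul hyc)
  obtain ⟨r1, r2⟩ := c2_of D1 D2 ((hk.smul hc).add hec)
  have big : ∀ x, x ∉ Icc (-(2*L)) (2*L) → 2 ≤ |x / L| := by
    intro x hx
    rw [abs_div, abs_of_pos hL0, le_div_iff₀ hL0]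
    by_contra h
    push Not at h
    exact hx ⟨by linarith [(abs_lt.1 h).1], by linarith [(abs_lt.1 h).2]⟩
  refine ⟨_, fun x => χ (x / L), e, r1, ?_, fun x => rfl, fun x => by rw [r2], ?_, ?_⟩
  · apply HasCompactSupport.intro (K := Icc (-(2*L)) (2*L)) isCompact_Icc
    intro x hx
    simp [(cout _ (big x hx)).1]
  · intro x hx
    refine cin _ ?_
    rw [abs_div, abs_of_pos hL0, div_le_one hL0]; exact hx
  · have e0 : ∀ x, x ∉ Icc (-(2*L)) (2*L) → ‖e x‖ ^ 2 = 0 := by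
      intro x hx
      obtain ⟨-, h1, h2⟩ := cout _ (big x hx)
      simp [e, h1, h2]
    rw [← setIntegral_eq_integral_of_forall_compl_eq_zero e0]
    have eb : ∀ x, ‖e x‖ ^ 2 ≤ (3 * (C * M) / L) ^ 2 := by
      intro x
      gcongr
      have a1 : ‖(2 * (χ1 (x / L) / L)) • y1 x‖ ≤ 2 * (C / L) * M := by
        rw [norm_smul]
        refine mul_le_mul ?_ (hy1 x) (norm_nonneg _) (by positivity)
        rw [Real.norm_eq_abs, abs_mul, abs_div, abs_of_pos hL0]
        have := cb1 (x/L); norm_num; gcongr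
      have a2 : ‖(χ2 (x / L) / L / L) • y x‖ ≤ (C / L) * M := by
        rw [norm_smul]
        refine mul_le_mul ?_ (hy x) (norm_nonneg _) (by positivity)
        rw [Real.norm_eq_abs, abs_div, abs_div, abs_of_pos hL0]
        have h1 := cb2 (x/L)
        have : |χ2 (x/L)| / L ≤ C / L := by gcongr
        exact (div_le_self (by positivity) hL).trans this
      calc _ ≤ _ := norm_add_le _ _
        _ ≤ 2 * (C / L) * M + (C / L) * M := add_le_add a1 a2
        _ = _ := by ring
    calc ∫ x in Icc (-(2*L)) (2*L), ‖e x‖ ^ 2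
        ≤ ∫ x in Icc (-(2*L)) (2*L), (3 * (C * M) / L) ^ 2 := by
          apply setIntegral_mono
          · exact (hec.norm.pow 2).continuousOn.integrableOn_compact isCompact_Icc
          · exact continuous_const.continuousOn.integrableOn_compact isCompact_Icc
          · exact eb
      _ = (4 * L) * (3 * (C * M) / L) ^ 2 := by
          rw [setIntegral_const, Real.volume_real_Icc_of_le (by linarith), smul_eq_mul]; ring
      _ = _ := by field_simp; ring

theorem kappa {a a1 : ℝ → ℝ} (ha : Cs a) (ha1 : Cs a1) (hd : ∀ x, HasDerivAt a (a1 x) x)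
    (κ : ℝ) : κ ^ 2 * ∫ x, a x ^ 2 ≤ ∫ x, (a1 x - κ * a x) ^ 2 := by
  have z : ∫ x, (a x * a1 x + a1 x * a x) = 0 := by
    apply integral_eq_zero_of_hasDerivAt_of_integrable (f := fun x => a x * a x)
    · intro x
      convert! (hd x).mul (hd x) using 1; ring
    · exact (Cs.mul ha.1 ha1).int.add (Cs.mul ha1.1 ha).int
    · exact (Cs.mul ha.1 ha).int
  have i0 : Integrable (fun x => a x * a1 x + a1 x * a x) :=
    (Cs.mul ha.1 ha1).int.add (Cs.mul ha1.1 ha).int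
  have : ∫ x, (a1 x - κ * a x) ^ 2 = (∫ x, a1 x ^ 2) + κ ^ 2 * ∫ x, a x ^ 2 := by
    have e : ∀ x, (a1 x - κ * a x) ^ 2 =
      (a1 x ^ 2 + κ ^ 2 * a x ^ 2) - κ * (a x * a1 x + a1 x * a x) := fun x => by ring
    simp_rw [e]
    rw [integral_sub, integral_add, integral_const_mul, integral_const_mul, z]
    · ring
    · exact ha1.sq
    · exact ha.sq.const_mul _
    · exact ha1.sq.add (ha.sq.const_mul _)
    · exact i0.const_mul _
  rw [this]
  have : 0 ≤ ∫ x, a1 x ^ 2 := integral_nonneg fun x => sq_nonneg _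
  linarith

theorem half_bound {q u φ φ1 : ℝ → ℝ} (hq : Continuous q) (hu : Tst u) {κ B : ℝ} 
    (hφ : IsSol q φ φ1) (hb : ∀ x, |Real.exp (-κ * x) * φ x| ≤ B) :
    Cs (fun x => Real.exp (-κ * x) * (φ x * deriv u x - φ1 x * u x)) ∧
    κ ^ 2 * ∫ x, (Real.exp (-κ * x) * (φ x * deriv u x - φ1 x * u x)) ^ 2 ≤
      B ^ 2 * ∫ x, Hf q u x ^ 2 := by
  have h1 := c2_to hu.1
  have cφ : Continuous φ := continuous_iff_continuousAt.2 fun x => (hφ.d1 x).continuousAt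
  have cφ1 : Continuous φ1 := continuous_iff_continuousAt.2 fun x => (hφ.d2 x).continuousAt
  have ce : Continuous fun x : ℝ => Real.exp (-κ * x) := by fun_prop
  have de : ∀ x, HasDerivAt (fun x : ℝ => Real.exp (-κ * x)) (Real.exp (-κ * x) * (-κ)) x :=
    fun x => by
      have := (((hasDerivAt_id x).const_mul (-κ)).exp)
      simpa using this
  have csub : ∀ {f g : ℝ → ℝ}, Cs f → Cs g → Cs (fun x => f x - g x) := fun hf hg => by
    have := hf.add (Cs.mul (f := fun _ => -1) continuous_const hg)
    simpa [sub_eq_add_neg] using this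
  have ca : Cs (fun x => Real.exp (-κ * x) * (φ x * deriv u x - φ1 x * u x)) :=
    Cs.mul ce (csub (Cs.mul cφ hu.cs1) (Cs.mul cφ1 hu.cs))
  refine ⟨ca, ?_⟩
  have ca1 : Cs (fun x => (-κ) * (Real.exp (-κ * x) * (φ x * deriv u x - φ1 x * u x)) -
      Real.exp (-κ * x) * φ x * Hf q u x) :=
    csub (Cs.mul continuous_const ca) (Cs.mul (ce.mul cφ) (hu.hf hq))
  have := kappa ca ca1 (fun x => by
    convert! (de x).mul (((hφ.d1 x).mul (h1.2.1 x)).sub ((hφ.d2 x).mul (h1.1 x))) using 1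
    simp only [Hf, Pi.mul_apply, Pi.sub_apply]; ring) (-κ)
  rw [neg_sq] at this
  refine this.trans ?_
  rw [← integral_const_mul]
  refine integral_mono ?_ ((hu.hf hq).sq.const_mul _) fun x => ?_
  · exact (csub ca1 (Cs.mul continuous_const ca)).sq
  · have hb := sq_le_sq' (neg_le_of_abs_le (hb x)) (le_of_abs_le (hb x))
    have : 0 ≤ Hf q u x ^ 2 := sq_nonneg _
    simp only
    calc _ = (Real.exp (-κ * x) * φ x) ^ 2 * Hf q u x ^ 2 := by ring
      _ ≤ _ := by gcongr

theorem Hyp.lower {q φ φ1 ψ ψ1 : ℝ → ℝ} {γ B : ℝ} (h : Hyp q γ B φ φ1 ψ ψ1)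
    (hq : Continuous q) : ∃ C : ℝ, 0 < C ∧ ∀ u, Tst u → ∫ x, u x ^ 2 ≤ C * ∫ x, Hf q u x ^ 2 := by
  have hB := h.Bpos
  have hγ := h.γpos
  have b1 : ∀ x, |Real.exp (-γ * x) * φ x| ≤ B := fun x => by
    rw [abs_mul, abs_of_pos (Real.exp_pos _)]
    calc _ ≤ Real.exp (-γ * x) * (B * Real.exp (γ * x)) := by gcongr; exact h.bφ x
      _ = B * Real.exp (-γ * x + γ * x) := by rw [Real.exp_add]; ring
      _ = B := by simp
  have b2 : ∀ x, |Real.exp (-(-γ) * x) * ψ x| ≤ B := fun x => by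
    rw [abs_mul, abs_of_pos (Real.exp_pos _)]
    calc _ ≤ Real.exp (-(-γ) * x) * (B * Real.exp (-γ * x)) := by gcongr; exact h.bψ x
      _ = B * Real.exp (-(-γ) * x + -γ * x) := by rw [Real.exp_add]; ring
      _ = B := by simp
  refine ⟨4 * B ^ 2 * (B ^ 2 / γ ^ 2), by positivity, fun u hu => ?_⟩
  obtain ⟨ca, ha⟩ := half_bound hq hu h.hφ b1
  obtain ⟨cb, hb⟩ := half_bound hq hu h.hψ b2
  rw [neg_sq] at hb
  set a := fun x => Real.exp (-γ * x) * (φ x * deriv u x - φ1 x * u x) with hadef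
  set b := fun x => Real.exp (-(-γ) * x) * (ψ x * deriv u x - ψ1 x * u x) with hbdef
  have key : ∀ x, u x ^ 2 ≤ 2 * B ^ 2 * a x ^ 2 + 2 * B ^ 2 * b x ^ 2 := by
    intro x
    have e : u x = (Real.exp (-(-γ) * x) * ψ x) * a x - (Real.exp (-γ * x) * φ x) * b x := by
      simp only [a, b]
      have e1 : Real.exp (-(-γ) * x) * Real.exp (-γ * x) = 1 := by
        rw [← Real.exp_add]; simp
      have e2 := h.wr x
      linear_combination (-1 + Real.exp (-(-γ) * x) * Real.exp (-γ * x)- Real.exp (-(-γ) * x) * Real.exp (-γ * x)) * u x * e2 + (-(u x) * (φ x * ψ1 x - φ1 x * ψ x)) * e1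
    have p1 := sq_le_sq' (neg_le_of_abs_le (b1 x)) (le_of_abs_le (b1 x))
    have p2 := sq_le_sq' (neg_le_of_abs_le (b2 x)) (le_of_abs_le (b2 x))
    set P := Real.exp (-(-γ) * x) * ψ x
    set R := Real.exp (-γ * x) * φ x
    rw [e]
    have q1 := mul_le_mul_of_nonneg_right p2 (sq_nonneg (a x))
    have q2 := mul_le_mul_of_nonneg_right p1 (sq_nonneg (b x))
    nlinarith [sq_nonneg (P * a x + R * b x)]
  have i1 : ∫ x, u x ^ 2 ≤ 2 * B ^ 2 * (∫ x, a x ^ 2) + 2 * B ^ 2 * ∫ x, b x ^ 2 := by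
    rw [← integral_const_mul, ← integral_const_mul, ← integral_add (ca.sq.const_mul _) (cb.sq.const_mul _)]
    exact integral_mono hu.cs.sq ((ca.sq.const_mul _).add (cb.sq.const_mul _)) key
  set I := ∫ x, Hf q u x ^ 2
  have ja : ∫ x, a x ^ 2 ≤ B ^ 2 / γ ^ 2 * I := by
    rw [div_mul_eq_mul_div, le_div_iff₀ (by positivity)]; linarith
  have jb : ∫ x, b x ^ 2 ≤ B ^ 2 / γ ^ 2 * I := by
    rw [div_mul_eq_mul_div, le_div_iff₀ (by positivity)]; linarith
  calc _ ≤ _ := i1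
    _ ≤ 2 * B ^ 2 * (B ^ 2 / γ ^ 2 * I) + 2 * B ^ 2 * (B ^ 2 / γ ^ 2 * I) := by gcongr
    _ = _ := by ring

theorem bdd_quasi {y : ℝ → ℂ} (hy : Continuous y) {T : ℝ} (hT : 0 < T) {z : ℂ} (hz : ‖z‖ = 1)
    (h : ∀ x, y (x + T) = z * y x) : ∃ B, ∀ x, ‖y x‖ ≤ B := by
  obtain ⟨B, -, hB⟩ := periodic_bdd (f := fun x => ‖y x‖) hy.norm hT
    (fun x => by rw [h x, norm_mul, hz, one_mul])
  exact ⟨B, fun x => by simpa using hB x⟩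

theorem elliptic_mem {W : ℝ → ℝ} (hW : Continuous W) {K : ℝ} (hWK : ∀ t, |W t| ≤ K) {T : ℝ}
    (hT : 0 < T) (hper : Function.Periodic W T) (E : ℝ) (hD : ‖disc W T E‖ ≤ 2) :
    E ∈ RS W := by
  obtain ⟨z, y, y1, hz, hs, p, p1, h0⟩ := elliptic_sol hW hWK hper E hD
  have cy : Continuous y := continuous_iff_continuousAt.2 fun x => (hs.d1 x).continuousAt
  have cy1 : Continuous y1 := continuous_iff_continuousAt.2 fun x => (hs.d2 x).continuousAt
  obtain ⟨B, hB⟩ := bdd_quasi cy hT hz p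
  obtain ⟨B1, hB1⟩ := bdd_quasi cy1 hT hz p1
  obtain ⟨M, hM⟩ := cut hs.d1 hs.d2 (by fun_prop) (M := max B B1)
    (fun x => (hB x).trans (le_max_left _ _)) (fun x => (hB1 x).trans (le_max_right _ _))
  have hc : 0 < ∫ x in Icc (-1:ℝ) 1, ‖y x‖ ^ 2 := by
    have hnz : ∃ x ∈ Ioo (-1:ℝ) 1, y x ≠ 0 := by
      by_contra hcon
      push Not at hcon
      have e0 : y =ᶠ[nhds 0] fun _ => 0 := by
        filter_upwards [Ioo_mem_nhds (show (-1:ℝ) < 0 by norm_num) one_pos] with x hx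
        exact hcon x hx
      rcases h0 with h | h
      · exact h e0.self_of_nhds
      · exact h ((hs.d1 0).unique ((hasDerivAt_const (0:ℝ) (0:ℂ)).congr_of_eventuallyEq e0))
    have cn : Continuous (fun x => ‖y x‖ ^ 2) := by fun_prop
    have hi : IntegrableOn (fun x => ‖y x‖ ^ 2) (Icc (-1:ℝ) 1) :=
      cn.continuousOn.integrableOn_compact isCompact_Icc
    rw [setIntegral_pos_iff_support_of_nonneg_ae
      (Eventually.of_forall fun x => sq_nonneg ‖y x‖) hi]
    obtain ⟨x, hx, hyx⟩ := hnz
    have ho : IsOpen ((Function.support fun x => ‖y x‖ ^ 2) ∩ Ioo (-1:ℝ) 1) :=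
      (cn.isOpen_support).inter isOpen_Ioo
    refine lt_of_lt_of_le (ho.measure_pos volume ⟨x, by simpa using hyx, hx⟩)
      (measure_mono (inter_subset_inter_right _ Ioo_subset_Icc_self))
  set c := ∫ x in Icc (-1:ℝ) 1, ‖y x‖ ^ 2 with hcdef
  intro ε hε
  obtain ⟨L, hL1, hL⟩ : ∃ L : ℝ, 1 ≤ L ∧ M / L < ε * c := by
    have : Tendsto (fun L : ℝ => M / L) atTop (nhds 0) := tendsto_const_nhds.div_atTop tendsto_id
    have h1 := this.eventually (gt_mem_nhds (show 0 < ε * c by positivity))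
    obtain ⟨L, h⟩ := ((eventually_ge_atTop 1).and h1).exists
    exact ⟨L, h.1, h.2⟩
  obtain ⟨u, k, e, hu, hcs, huk, hdd, hk, he⟩ := hM L hL1
  refine split_real hW hu hcs ?_
  have e1 : ∀ x, -deriv (deriv u) x + (W x : ℂ) * u x - (E : ℂ) * u x = - e x := by
    intro x; rw [hdd, huk]; simp only [Complex.real_smul]; push_cast; ring
  simp_rw [e1, norm_neg]
  have i1 : c ≤ ∫ x, ‖u x‖ ^ 2 := by
    have hui : Integrable (fun x => ‖u x‖ ^ 2) := by
      have cu := hu.continuous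
      have c1 : Continuous (fun x => ‖u x‖ ^ 2) := by fun_prop
      have c2 : HasCompactSupport (fun x => ‖u x‖ ^ 2) :=
        hcs.norm.comp_left (g := fun t : ℝ => t ^ 2) (by norm_num)
      exact c1.integrable_of_hasCompactSupport c2
    calc c = ∫ x in Icc (-1:ℝ) 1, ‖u x‖ ^ 2 := by
          rw [hcdef]
          apply setIntegral_congr_fun measurableSet_Icc
          intro x hx
          simp only [huk, hk x ((abs_le.2 ⟨hx.1, hx.2⟩).trans hL1), one_smul]
      _ ≤ _ := setIntegral_le_integral hui (Eventually.of_forall fun x => by positivity)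
  calc _ ≤ M / L := he
    _ < ε * c := hL
    _ ≤ _ := by gcongr

theorem Hyp.dense {q φ φ1 ψ ψ1 : ℝ → ℝ} {γ B : ℝ} (h : Hyp q γ B φ φ1 ψ ψ1)
    (hq : Continuous q) {g : ℝ → ℝ} (hg : Cs g) {η : ℝ} (hη : 0 < η) :
    ∃ w, Tst w ∧ ∫ x, (Hf q w x - g x) ^ 2 < η := by
  have cφ : Continuous φ := continuous_iff_continuousAt.2 fun x => (h.hφ.d1 x).continuousAt
  have cψ : Continuous ψ := continuous_iff_continuousAt.2 fun x => (h.hψ.d1 x).continuousAt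
  have cφ1 : Continuous φ1 := continuous_iff_continuousAt.2 fun x => (h.hφ.d2 x).continuousAt
  have cψ1 : Continuous ψ1 := continuous_iff_continuousAt.2 fun x => (h.hψ.d2 x).continuousAt
  have hgc := hg.1
  have hB := h.Bpos
  have hγ := h.γpos
  obtain ⟨R, hR0, hR⟩ : ∃ R : ℝ, 0 < R ∧ ∀ x, R ≤ |x| → g x = 0 := by
    obtain ⟨R, hR0, hR⟩ := hg.2.exists_pos_le_norm
    exact ⟨R, hR0, fun x hx => hR x hx⟩
  set P : ℝ → ℝ := fun x => ∫ t in (-R)..x, φ t * g t with hP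
  set S : ℝ → ℝ := fun x => ∫ t in R..x, ψ t * g t with hS
  have dP : ∀ x, HasDerivAt P (φ x * g x) x := fun x =>
    (cφ.mul hgc).integral_hasStrictDerivAt _ _ |>.hasDerivAt
  have dS : ∀ x, HasDerivAt S (ψ x * g x) x := fun x =>
    (cψ.mul hgc).integral_hasStrictDerivAt _ _ |>.hasDerivAt
  set w : ℝ → ℝ := fun x => φ x * S x - ψ x * P x with hw
  set w1 : ℝ → ℝ := fun x => φ1 x * S x - ψ1 x * P x with hw1
  have d1 : ∀ x, HasDerivAt w (w1 x) x := fun x => by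
    convert! ((h.hφ.d1 x).mul (dS x)).sub ((h.hψ.d1 x).mul (dP x)) using 1
    simp only [hw1]; ring
  have d2 : ∀ x, HasDerivAt w1 (q x * w x - g x) x := fun x => by
    convert! ((h.hφ.d2 x).mul (dS x)).sub ((h.hψ.d2 x).mul (dP x)) using 1
    have := h.wr x
    simp only [hw]; linear_combination (g x) * this
  have P0 : ∀ x, x ≤ -R → P x = 0 := by
    intro x hx
    apply intervalIntegral.integral_zero_ae
    refine Eventually.of_forall fun t ht => ?_
    rw [uIoc_of_ge hx] at ht
    rw [hR t (by rw [abs_of_nonpos (by linarith [ht.2])]; linarith [ht.2]), mul_zero]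
  have S0 : ∀ x, R ≤ x → S x = 0 := by
    intro x hx
    apply intervalIntegral.integral_zero_ae
    refine Eventually.of_forall fun t ht => ?_
    rw [uIoc_of_le hx] at ht
    rw [hR t (ht.1.le.trans (le_abs_self t)), mul_zero]
  have PR : ∀ x, R ≤ x → P x = P R := by
    intro x hx
    have : P x - P R = ∫ t in R..x, φ t * g t :=
      intervalIntegral.integral_interval_sub_left ((cφ.mul hgc).intervalIntegrable _ _)
        ((cφ.mul hgc).intervalIntegrable _ _)
    have z : ∫ t in R..x, φ t * g t = 0 := by
      apply intervalIntegral.integral_zero_ae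
      refine Eventually.of_forall fun t ht => ?_
      rw [uIoc_of_le hx] at ht
      rw [hR t (ht.1.le.trans (le_abs_self t)), mul_zero]
    linarith
  have SR : ∀ x, x ≤ -R → S x = S (-R) := by
    intro x hx
    have : S x - S (-R) = ∫ t in (-R)..x, ψ t * g t :=
      intervalIntegral.integral_interval_sub_left ((cψ.mul hgc).intervalIntegrable _ _)
        ((cψ.mul hgc).intervalIntegrable _ _)
    have z : ∫ t in (-R)..x, ψ t * g t = 0 := by
      apply intervalIntegral.integral_zero_ae
      refine Eventually.of_forall fun t ht => ?_
      rw [uIoc_of_ge hx] at ht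
      rw [hR t (by rw [abs_of_nonpos (by linarith [ht.2])]; linarith [ht.2]), mul_zero]
    linarith
  have bdd : ∀ f f' : ℝ → ℝ, Continuous f → Continuous f' →
      (∀ x, |f x| ≤ B * Real.exp (γ * x)) → (∀ x, |f' x| ≤ B * Real.exp (-γ * x)) →
      Continuous (fun x => f x * S x - f' x * P x) →
      ∃ D, ∀ x, ‖f x * S x - f' x * P x‖ ≤ D := by
    intro f f' _ _ b b' hcont
    obtain ⟨D, hD⟩ := (isCompact_Icc (a := -R) (b := R)).exists_bound_of_continuousOn
      hcont.continuousOn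
    refine ⟨max D (max (B * |S (-R)|) (B * |P R|)), fun x => ?_⟩
    rcases le_total x (-R) with hx | hx
    · refine le_trans ?_ ((le_max_left _ _).trans (le_max_right _ _))
      rw [P0 x hx, SR x hx, mul_zero, sub_zero, norm_mul, Real.norm_eq_abs, Real.norm_eq_abs]
      gcongr
      refine (b x).trans (mul_le_of_le_one_right hB.le (Real.exp_le_one_iff.2 ?_))
      nlinarith
    · rcases le_total x R with hx' | hx'
      · exact (hD x ⟨hx, hx'⟩).trans (le_max_left _ _)
      · refine le_trans ?_ ((le_max_right _ _).trans (le_max_right _ _))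
        rw [S0 x hx', PR x hx', mul_zero, zero_sub, norm_neg, norm_mul, Real.norm_eq_abs,
          Real.norm_eq_abs]
        gcongr
        refine (b' x).trans (mul_le_of_le_one_right hB.le (Real.exp_le_one_iff.2 ?_))
        nlinarith
  have cw : Continuous w := continuous_iff_continuousAt.2 fun x => (d1 x).continuousAt
  have cw1 : Continuous w1 := continuous_iff_continuousAt.2 fun x => (d2 x).continuousAt
  obtain ⟨D, hD⟩ := bdd φ ψ cφ cψ h.bφ h.bψ cw
  obtain ⟨D1, hD1⟩ := bdd φ1 ψ1 cφ1 cψ1 h.bφ1 h.bψ1 cw1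
  obtain ⟨M, hM⟩ := cut d1 d2 (by fun_prop) (M := max D D1)
    (fun x => (hD x).trans (le_max_left _ _)) (fun x => (hD1 x).trans (le_max_right _ _))
  obtain ⟨L, hL1, hLR, hL⟩ : ∃ L : ℝ, 1 ≤ L ∧ R ≤ L ∧ M / L < η := by
    have : Tendsto (fun L : ℝ => M / L) atTop (nhds 0) := tendsto_const_nhds.div_atTop tendsto_id
    have h1 := this.eventually (gt_mem_nhds hη)
    obtain ⟨L, h⟩ := ((eventually_ge_atTop 1).and ((eventually_ge_atTop R).and h1)).exists
    exact ⟨L, h.1, h.2.1, h.2.2⟩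
  obtain ⟨u, k, e, hu, hcs, huk, hdd, hk, he⟩ := hM L hL1
  refine ⟨u, ⟨hu, hcs⟩, ?_⟩
  refine lt_of_le_of_lt (le_of_eq ?_) (lt_of_le_of_lt he hL)
  congr 1; funext x
  rw [Real.norm_eq_abs, sq_abs]
  have kg : k x * g x = g x := by
    rcases le_total (|x|) L with hx | hx
    · rw [hk x hx, one_mul]
    · rw [hR x (hLR.trans hx), mul_zero]
  simp only [Hf, hdd, huk, smul_eq_mul]
  rw [show -(k x * (q x * w x - g x) + e x) + q x * (k x * w x) - g x = - e x by
    linear_combination kg]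
  ring

theorem mem_RS_iff {W : ℝ → ℝ} (hW : Continuous W) {K : ℝ} (hWK : ∀ t, |W t| ≤ K) {T : ℝ}
    (hT : 0 < T) (hper : Function.Periodic W T) (E : ℝ) : E ∈ RS W ↔ ‖disc W T E‖ ≤ 2 := by
  refine ⟨fun h => ?_, elliptic_mem hW hWK hT hper E⟩
  by_contra hD
  push Not at hD
  obtain ⟨γ, B, φ, φ1, ψ, ψ1, hh⟩ := hyp_exists hW hWK hT hper E hD
  obtain ⟨C, hC, hl⟩ := hh.lower (by fun_prop)
  obtain ⟨u, hu, h1⟩ := h C⁻¹ (inv_pos.2 hC)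
  have h2 := hl u hu
  have : ∫ x, u x ^ 2 < C * (C⁻¹ * ∫ x, u x ^ 2) := lt_of_le_of_lt h2 (by gcongr)
  rw [mul_inv_cancel_left₀ hC.ne'] at this
  exact lt_irrefl _ this

theorem stab {W W' : ℝ → ℝ} (hW : Continuous W) (hW' : Continuous W') {K : ℝ}
    (hWK : ∀ t, |W t| ≤ K) {T : ℝ}
    (hT : 0 < T) (hper : Function.Periodic W T) {r : ℝ} (hr : ∀ t, |W t - W' t| ≤ r) {E : ℝ}
    (hE : E ∈ RS W') : ∃ E' ∈ RS W, |E' - E| ≤ r := by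
  have hr0 : 0 ≤ r := (abs_nonneg _).trans (hr 0)
  refine stab_aux hW E r hr0 ?_ ?_
  · intro ε hε
    set t := ε / (2 * (r ^ 2 + 1)) with ht
    have ht0 : 0 < t := by positivity
    have htr : t * r ^ 2 ≤ ε / 2 := by
      rw [ht, div_mul_eq_mul_div, div_le_div_iff₀ (by positivity) (by norm_num)]
      nlinarith [sq_nonneg r]
    set ε' := (ε / 2) / (1 + 1 / t) with hε'
    have hε'0 : 0 < ε' := by positivity
    have hmul : (1 + 1 / t) * ε' = ε / 2 := by rw [hε']; field_simp
    obtain ⟨u, hu, h1⟩ := hE ε' hε'0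
    have hf0 : 0 ≤ ∫ x, Hf (fun x => W' x - E) u x ^ 2 := integral_nonneg fun x => sq_nonneg _
    have hn0 : 0 < ∫ x, u x ^ 2 :=
      (pos_iff_pos_of_mul_pos (lt_of_le_of_lt hf0 h1)).1 hε'0
    refine ⟨u, hu, hn0, ?_⟩
    have q' : Continuous fun x => W' x - E := by fun_prop
    have q : Continuous fun x => W x - E := by fun_prop
    have key : ∀ x, Hf (fun x => W x - E) u x ^ 2 ≤
        (1 + 1 / t) * Hf (fun x => W' x - E) u x ^ 2 + ((1 + t) * r ^ 2) * u x ^ 2 := by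
      intro x
      have e : Hf (fun x => W x - E) u x = Hf (fun x => W' x - E) u x + (W x - W' x) * u x := by
        simp only [Hf]; ring
      rw [e]
      set a := Hf (fun x => W' x - E) u x
      have hb : ((W x - W' x) * u x) ^ 2 ≤ r ^ 2 * u x ^ 2 := by
        rw [mul_pow]
        exact mul_le_mul_of_nonneg_right
          (sq_le_sq' (neg_le_of_abs_le (hr x)) (le_of_abs_le (hr x))) (sq_nonneg _)
      set b := (W x - W' x) * u x
      have : (a + b) ^ 2 ≤ (1 + 1 / t) * a ^ 2 + (1 + t) * b ^ 2 := by
        have : 0 ≤ (a - t * b) ^ 2 / t := by positivity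
        have e : (a - t * b) ^ 2 / t = 1 / t * a ^ 2 - 2 * a * b + t * b ^ 2 := by
          field_simp; ring
        nlinarith
      nlinarith
    have i1 := integral_mono (hu.hf q).sq
      (((hu.hf q').sq.const_mul (1 + 1 / t)).add (hu.cs.sq.const_mul ((1 + t) * r ^ 2))) key
    simp only [Pi.add_apply] at i1
    rw [integral_add ((hu.hf q').sq.const_mul (1 + 1 / t)) (hu.cs.sq.const_mul ((1 + t) * r ^ 2)),
      integral_const_mul, integral_const_mul] at i1
    have i2 : (1 + 1 / t) * ∫ x, Hf (fun x => W' x - E) u x ^ 2 ≤ ε / 2 * ∫ x, u x ^ 2 := by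
      rw [← hmul, mul_assoc]; gcongr
    nlinarith
  · intro E' hE' g hg η hη
    rw [mem_RS_iff hW hWK hT hper, not_le] at hE'
    obtain ⟨γ, B, φ, φ1, ψ, ψ1, hh⟩ := hyp_exists hW hWK hT hper E' hE'
    exact hh.dense (by fun_prop) hg hη

theorem disc_re {W : ℝ → ℝ} (hW : Continuous W) {K : ℝ} (hWK : ∀ t, |W t| ≤ K) (T E : ℝ) :
    disc W T E = (((disc W T E).re : ℝ) : ℂ) := by
  obtain ⟨c, c1, s, s1, -, -, hd⟩ := fund_real hW hWK E
  rw [hd T]; simp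

theorem edge_exists {W : ℝ → ℝ} (hW : Continuous W) {K : ℝ} (hWK : ∀ t, |W t| ≤ K) {T : ℝ}
    (hT : 0 < T) (hper : Function.Periodic W T) {E N ε : ℝ} (hε : 0 < ε) (hE : E ∈ RS W)
    (h1 : -N ≤ E) (h2 : E + ε ≤ N)
    (hvol : (volume (RS W ∩ Icc (-N) N)).toReal < ε) :
    ∃ z ∈ Icc E (E + ε), disc W T z ^ 2 = 4 := by
  obtain ⟨g, hg, hgs⟩ : ∃ g ∈ Icc E (E + ε), g ∉ RS W := by
    by_contra hcon
    push Not at hcon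
    have hsub : Icc E (E + ε) ⊆ RS W ∩ Icc (-N) N := fun x hx =>
      ⟨hcon x hx, by linarith [hx.1], by linarith [hx.2]⟩
    have hfin : volume (RS W ∩ Icc (-N) N) ≠ ⊤ :=
      ((measure_mono inter_subset_right).trans_lt isCompact_Icc.measure_lt_top).ne
    have := ENNReal.toReal_mono hfin (measure_mono (μ := volume) hsub)
    rw [Real.volume_Icc, add_sub_cancel_left, ENNReal.toReal_ofReal hε.le] at this
    linarith
  rw [mem_RS_iff hW hWK hT hper] at hE hgs
  push Not at hgs
  rw [disc_re hW hWK, Complex.norm_real, Real.norm_eq_abs] at hE hgs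
  set f : ℝ → ℝ := fun x => (disc W T x).re ^ 2 with hf
  have hdc := (disc_diff hW hWK T).continuous
  have hfc : Continuous f := by
    have : Continuous fun x : ℝ => (disc W T x).re :=
      Complex.continuous_re.comp (hdc.comp Complex.continuous_ofReal)
    exact this.pow 2
  have a1 : f E ≤ 4 := by
    have := sq_le_sq' (neg_le_of_abs_le hE) (le_of_abs_le hE)
    simp only [hf]; linarith
  have a2 : 4 ≤ f g := by
    simp only [hf]; rw [← sq_abs]; nlinarith
  obtain ⟨z, hz, hz4⟩ := intermediate_value_Icc hg.1 hfc.continuousOn ⟨a1, a2⟩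
  refine ⟨z, ⟨hz.1, hz.2.trans hg.2⟩, ?_⟩
  rw [disc_re hW hWK]
  have : ((f z : ℝ) : ℂ) = 4 := by rw [hz4]; norm_num
  simpa [hf] using this

theorem cover {K R C : ℝ} 
    (hC : ∀ (W : ℝ → ℝ) (T : ℝ), Continuous W → (∀ t, |W t| ≤ K) → 1 ≤ T →
      ∀ s : Finset ℝ, (∀ x ∈ s, |x| ≤ R + 3 ∧ disc W T x ^ 2 = 4) → (s.card : ℝ) ≤ C * T)
    {W W' : ℝ → ℝ} (hW : Continuous W) (hW' : Continuous W')
    (hWK : ∀ t, |W t| ≤ K) {T : ℝ}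
    (hT : 1 ≤ T) (hper : Function.Periodic W T) {ε N : ℝ} (hε : 0 < ε) (hε1 : ε ≤ 1)
    (hr : ∀ t, |W t - W' t| ≤ ε) (hN : R + 3 ≤ N)
    (hvol : (volume (RS W ∩ Icc (-N) N)).toReal < ε) :
    ∃ S : Finset ℝ, (S.card : ℝ) ≤ C * T ∧
      RS W' ∩ Icc (-R) R ⊆ ⋃ i : S, Metric.closedBall (i : ℝ) (4 * ε) := by
  classical
  have hT0 : 0 < T := by linarith
  have sep : ∀ S : Finset ℝ, (∀ e ∈ S, e ∈ RS W' ∩ Icc (-R) R) →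
      (∀ e ∈ S, ∀ e' ∈ S, e ≠ e' → 4 * ε < |e - e'|) → (S.card : ℝ) ≤ C * T := by
    intro S hS hsep
    have hz : ∀ e : ℝ, ∃ z : ℝ, e ∈ S → |z - e| ≤ 2 * ε ∧ disc W T z ^ 2 = 4 := by
      intro e
      by_cases he : e ∈ S
      · obtain ⟨hm, h1, h2⟩ := hS e he
        obtain ⟨E, hE, hd⟩ := stab hW hW' hWK hT0 hper hr hm
        rw [abs_le] at hd
        obtain ⟨z, hz, hz4⟩ := edge_exists hW hWK hT0 hper (N := N) hε hE (by linarith)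
          (by linarith) hvol
        exact ⟨z, fun _ => ⟨abs_le.2 ⟨by linarith [hz.1], by linarith [hz.2]⟩, hz4⟩⟩
      · exact ⟨0, fun h => absurd h he⟩
    choose z hz using hz
    have hinj : Set.InjOn z S := by
      intro e he e' he' hee
      by_contra hne
      have := hsep e he e' he' hne
      have a := abs_le.1 (hz e he).1
      have b := abs_le.1 (hz e' he').1
      rw [hee] at a
      have : |e - e'| ≤ 4 * ε := abs_le.2 ⟨by linarith, by linarith⟩
      linarith
    rw [← Finset.card_image_of_injOn hinj]
    refine hC W T hW hWK hT _ ?_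
    intro x hx
    obtain ⟨e, he, rfl⟩ := Finset.mem_image.1 hx
    refine ⟨?_, (hz e he).2⟩
    have a := abs_le.1 (hz e he).1
    obtain ⟨-, h1, h2⟩ := hS e he
    exact abs_le.2 ⟨by linarith, by linarith⟩
  let P : ℕ → Prop := fun n => ∃ S : Finset ℝ, (∀ e ∈ S, e ∈ RS W' ∩ Icc (-R) R) ∧
      (∀ e ∈ S, ∀ e' ∈ S, e ≠ e' → 4 * ε < |e - e'|) ∧ S.card = n
  have P0 : P 0 := ⟨∅, by simp, by simp, rfl⟩
  obtain ⟨S, hS, hsep, hcard⟩ := Nat.findGreatest_spec (P := P) (Nat.zero_le ⌊C * T⌋₊) P0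
  refine ⟨S, sep S hS hsep, ?_⟩
  intro x hx
  by_contra hcon
  simp only [mem_iUnion, Metric.mem_closedBall, Real.dist_eq, not_exists, not_le] at hcon
  have hcon : ∀ e ∈ S, 4 * ε < |x - e| := fun e he => hcon ⟨e, he⟩
  have hxS : x ∉ S := fun h => by
    have := hcon x h
    simp at this; linarith
  have hS' : ∀ e ∈ insert x S, e ∈ RS W' ∩ Icc (-R) R := by
    intro e he
    rcases Finset.mem_insert.1 he with rfl | he
    · exact hx
    · exact hS e he
  have hsep' : ∀ e ∈ insert x S, ∀ e' ∈ insert x S, e ≠ e' → 4 * ε < |e - e'| := by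
    intro e he e' he' hne
    rcases Finset.mem_insert.1 he with h | h <;> rcases Finset.mem_insert.1 he' with h' | h'
    · exact absurd (h.trans h'.symm) hne
    · rw [h]; exact hcon e' h'
    · rw [h', abs_sub_comm]; exact hcon e h
    · exact hsep e h e' h' hne
  have hle := sep _ hS' hsep'
  have h3 := Nat.le_findGreatest (P := P) (Nat.le_floor hle) ⟨_, hS', hsep', rfl⟩
  rw [Finset.card_insert_of_notMem hxS] at h3
  omega

theorem lim_zero {α C : ℝ} (hα : 0 < α) {T : ℕ → ℝ} (hT : Tendsto T atTop atTop) :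
    Tendsto (fun n => C * T n * (8 * Real.exp (-√(T n))) ^ α) atTop (nhds 0) := by
  have h1 := tendsto_rpow_mul_exp_neg_mul_atTop_nhds_zero 2 α hα
  have h2 : Tendsto (fun n => √(T n)) atTop atTop := Real.tendsto_sqrt_atTop.comp hT
  have h3 := (h1.comp h2).const_mul (C * 8 ^ α)
  rw [mul_zero] at h3
  refine h3.congr' ?_
  filter_upwards [hT.eventually_ge_atTop 0] with n hn
  simp only [Function.comp]
  rw [Real.mul_rpow (by norm_num) (Real.exp_pos _).le, ← Real.exp_mul, Real.rpow_two,
    Real.sq_sqrt hn, show -√(T n) * α = -α * √(T n) by ring]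
  ring

theorem haus_zero (X : Set ℝ) {α C : ℝ} (hα : 0 < α) {T : ℕ → ℝ} (hT : Tendsto T atTop atTop)
    (h : ∀ᶠ n in atTop, ∃ S : Finset ℝ, (S.card : ℝ) ≤ C * T n ∧
      X ⊆ ⋃ i : S, Metric.closedBall (i : ℝ) (4 * Real.exp (-√(T n)))) : μH[α] X = 0 := by
  have h' : ∀ n, ∃ S : Finset ℝ, (∃ S : Finset ℝ, (S.card : ℝ) ≤ C * T n ∧
      X ⊆ ⋃ i : S, Metric.closedBall (i : ℝ) (4 * Real.exp (-√(T n)))) →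
      (S.card : ℝ) ≤ C * T n ∧
      X ⊆ ⋃ i : S, Metric.closedBall (i : ℝ) (4 * Real.exp (-√(T n))) := by
    intro n
    by_cases hh : (∃ S : Finset ℝ, (S.card : ℝ) ≤ C * T n ∧
      X ⊆ ⋃ i : S, Metric.closedBall (i : ℝ) (4 * Real.exp (-√(T n))))
    · obtain ⟨S, hS⟩ := hh; exact ⟨S, fun _ => hS⟩
    · exact ⟨∅, fun h => absurd h hh⟩
  choose S hS using h'
  have hS : ∀ᶠ n in atTop, ((S n).card : ℝ) ≤ C * T n ∧
      X ⊆ ⋃ i : S n, Metric.closedBall (i : ℝ) (4 * Real.exp (-√(T n))) := by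
    filter_upwards [h] with n hn using hS n hn
  have hd : ∀ n (i : S n), Metric.ediam (Metric.closedBall (i : ℝ) (4 * Real.exp (-√(T n)))) ≤
      ENNReal.ofReal (8 * Real.exp (-√(T n))) := by
    intro n i
    rw [Real.closedBall_eq_Icc, Real.ediam_Icc]
    apply ENNReal.ofReal_le_ofReal; linarith
  have hr : Tendsto (fun n => ENNReal.ofReal (8 * Real.exp (-√(T n)))) atTop (nhds 0) := by
    rw [← ENNReal.ofReal_zero]
    apply ENNReal.tendsto_ofReal
    have h2 : Tendsto (fun n => √(T n)) atTop atTop := Real.tendsto_sqrt_atTop.comp hT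
    have := (Real.tendsto_exp_neg_atTop_nhds_zero.comp h2).const_mul 8
    simpa using this
  have key := Measure.hausdorffMeasure_le_liminf_sum (ι := fun n : ℕ => {x // x ∈ S n}) α X
    (l := atTop) _ hr (fun n i => Metric.closedBall (i : ℝ) (4 * Real.exp (-√(T n))))
    (Eventually.of_forall fun n => hd n) (hS.mono fun n hn => hn.2)
  have hlim : Tendsto (fun n => ∑ i : S n,
      Metric.ediam (Metric.closedBall (i : ℝ) (4 * Real.exp (-√(T n)))) ^ α) atTop (nhds 0) := by
    have h0 := ENNReal.tendsto_ofReal (lim_zero (C := C) hα hT)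
    rw [ENNReal.ofReal_zero] at h0
    refine tendsto_of_tendsto_of_tendsto_of_le_of_le' tendsto_const_nhds h0
      (Eventually.of_forall fun n => zero_le) ?_
    filter_upwards [hS] with n hn
    calc _ ≤ ∑ i : S n, ENNReal.ofReal (8 * Real.exp (-√(T n))) ^ α :=
          Finset.sum_le_sum fun i _ => ENNReal.rpow_le_rpow (hd n i) hα.le
      _ = ENNReal.ofReal ((S n).card * (8 * Real.exp (-√(T n))) ^ α) := by
          rw [Finset.sum_const, Finset.card_univ, Fintype.card_coe, nsmul_eq_mul,
            ENNReal.ofReal_rpow_of_nonneg (by positivity) hα.le,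
            ← ENNReal.ofReal_natCast, ← ENNReal.ofReal_mul (by positivity)]
      _ ≤ _ := by
          apply ENNReal.ofReal_le_ofReal
          have := hn.1
          gcongr
  rw [hlim.liminf_eq] at key
  exact le_antisymm key (zero_le)
/-- Let `λ, Q > 0`, `Λ_n = r_n = 2ⁿ`, and let `(V_n)` be continuous
`T_n`-periodic potentials with `T_1 > 1`, `T_n ≥ 2T_{n-1}`, `‖V_n‖_∞ ≤ Q`. Let `V_∞` be
bounded continuous such that for every `n ≥ 1` with `λ ∈ [Λ_n⁻¹, Λ_n]` one has
`‖λV_n - λV_∞‖_∞ ≤ δ_n/2` where `δ_n := Leb(σ(H_{λV_n}) ∩ [-r_n, r_n]) < e^{-√T_n}`.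
Then `σ(H_{λV_∞})` has Hausdorff dimension zero; indeed `h^α(σ(H_{λV_∞})) = 0` for every
`α > 0`. -/
theorem hausdorff_dimension_zero_of_rapid_approx
    (lam Q : ℝ) (hlam : 0 < lam) (hQ : 0 < Q)
    (V : ℕ → ℝ → ℝ) (T : ℕ → ℝ) (Vinf : ℝ → ℝ)
    (hVc : ∀ n, Continuous (V n)) (hper : ∀ n, Function.Periodic (V n) (T n))
    (hT1 : 1 < T 1) (hTgrow : ∀ n : ℕ, 2 ≤ n → 2 * T (n - 1) ≤ T n)
    (hbd : ∀ n x, |V n x| ≤ Q)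
    (hVinfc : Continuous Vinf) (hVinfbd : ∃ M : ℝ, ∀ x, |Vinf x| ≤ M)
    (happrox : ∀ n : ℕ, 1 ≤ n → ((2 : ℝ) ^ n)⁻¹ ≤ lam → lam ≤ (2 : ℝ) ^ n →
      (⨆ x : ℝ, |lam * V n x - lam * Vinf x|) ≤
        (volume (schrodingerSpectrum (fun x => lam * V n x) ∩
          Set.Icc (-(2 : ℝ) ^ n) ((2 : ℝ) ^ n))).toReal / 2 ∧
      (volume (schrodingerSpectrum (fun x => lam * V n x) ∩
          Set.Icc (-(2 : ℝ) ^ n) ((2 : ℝ) ^ n))).toReal < Real.exp (-Real.sqrt (T n))) :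
    dimH (schrodingerSpectrum fun x => lam * Vinf x) = 0 ∧
      ∀ α : ℝ, 0 < α → μH[α] (schrodingerSpectrum fun x => lam * Vinf x) = 0 := by
  have hc' : Continuous fun x => lam * Vinf x := by fun_prop
  have hTpow : ∀ n : ℕ, (2:ℝ) ^ n ≤ T (n + 1) := by
    intro n
    induction n with
    | zero => simpa using hT1.le
    | succ k ih =>
      have := hTgrow (k + 1 + 1) (by omega)
      simp only [Nat.add_sub_cancel] at this
      rw [pow_succ]; linarith
  have h2 : Tendsto (fun n : ℕ => (2:ℝ) ^ n) atTop atTop :=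
    tendsto_pow_atTop_atTop_of_one_lt one_lt_two
  have hTt : Tendsto T atTop atTop := by
    rw [← tendsto_add_atTop_iff_nat 1]
    exact tendsto_atTop_mono hTpow h2
  rw [spec_iff hc']
  have main : ∀ α : ℝ, 0 < α → μH[α] (RS fun x => lam * Vinf x) = 0 := by
    intro α hα
    have hU : RS (fun x => lam * Vinf x) ⊆
        ⋃ R : ℕ, RS (fun x => lam * Vinf x) ∩ Icc (-(R:ℝ)) R := by
      intro x hx
      obtain ⟨R, hR⟩ := exists_nat_ge |x|
      exact mem_iUnion.2 ⟨R, hx, abs_le.1 hR⟩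
    refine measure_mono_null hU (measure_iUnion_null fun R => ?_)
    obtain ⟨C, -, hC⟩ := disc_count (lam * Q) (R + 3) (by positivity) (by positivity)
    refine haus_zero _ (C := C) hα hTt ?_
    filter_upwards [eventually_ge_atTop 1, hTt.eventually_ge_atTop 1,
      h2.eventually_ge_atTop lam, h2.eventually_ge_atTop lam⁻¹,
      h2.eventually_ge_atTop ((R:ℝ) + 3)] with n hn hTn hl1 hl2 hRn
    have hWc : Continuous fun x => lam * V n x := by have := hVc n; fun_prop
    obtain ⟨hs, hv⟩ := happrox n hn (inv_le_of_inv_le₀ hlam hl2) hl1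
    rw [spec_iff hWc] at hs hv
    refine cover hC hWc hc' (fun t => ?_) hTn (fun x => ?_) (Real.exp_pos _)
      (Real.exp_le_one_iff.2 (by simp)) (fun t => ?_) hRn hv
    · rw [abs_mul, abs_of_pos hlam]
      exact mul_le_mul_of_nonneg_left (hbd n t) hlam.le
    · simp only [hper n x]
    · obtain ⟨M, hM⟩ := hVinfbd
      have hb : BddAbove (range fun x : ℝ => |lam * V n x - lam * Vinf x|) := by
        refine ⟨lam * (Q + M), ?_⟩
        rintro _ ⟨x, rfl⟩
        simp only
        rw [← mul_sub, abs_mul, abs_of_pos hlam]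
        gcongr
        exact (abs_sub _ _).trans (add_le_add (hbd n x) (hM x))
      have h1 := le_ciSup hb t
      have h0 : (0:ℝ) ≤ (volume (RS (fun x => lam * V n x) ∩
          Set.Icc (-(2 : ℝ) ^ n) ((2 : ℝ) ^ n))).toReal := ENNReal.toReal_nonneg
      linarith
  refine ⟨?_, main⟩
  refine le_antisymm (le_of_forall_gt_imp_ge_of_dense fun d hd => ?_) (zero_le)
  rcases eq_or_ne d ⊤ with rfl | hdt
  · exact le_top
  · lift d to NNReal using hdt
    refine dimH_le_of_hausdorffMeasure_ne_top ?_
    rw [main d (by exact_mod_cast hd)]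
    exact ENNReal.zero_ne_top
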